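/- Let G be a finitely generated group, E an admissible family of subgroups of G, and T a minimal E-tree in which every vertex has valence at least 3. For every cylinder Y of T, there is at most one non-peripheral cross-connected component of B(T) based on Y; such a component exists if and only if the cardinality of ∂Y is not 2 and not 3. -/

import Mathlib

open scoped Pointwise symmDiff

namespace SSRN

section Group
variable {G : Type*} [Group G]

/-- A subset of `G` is `H`-finite if it is contained in finitely many orbits of the
action of `H` on `G` by left multiplication. -/
def HFin (H : Subgroup G) (X : Set G) : Prop :=
  ∃ F : Finset G, X ⊆ ⋃ f ∈ F, (· * f) '' (H : Set G)

/-- Two subsets of `G` are `H`-equivalent if their symmetric difference is `H`-finite. -/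
def AIEquiv (H : Subgroup G) (X Y : Set G) : Prop := HFin H (X ∆ Y)

/-- `X` is an `H`-almost invariant subset of `G`. -/
def IsAI (H : Subgroup G) (X : Set G) : Prop :=
  (∀ h ∈ H, (h * ·) '' X = X) ∧ ∀ s : G, HFin H (((· * s) '' X) ∆ X)

/-- `X` is a non-trivial `H`-almost invariant subset of `G`. -/
def NontrivAI (H : Subgroup G) (X : Set G) : Prop :=
  IsAI H X ∧ ¬ HFin H X ∧ ¬ HFin H Xᶜ

/-- The `H`-almost invariant set `X` crosses `Y`: none of the four corners is `H`-finite. -/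
def Crosses (H : Subgroup G) (X Y : Set G) : Prop :=
  ¬ HFin H (X ∩ Y) ∧ ¬ HFin H (X ∩ Yᶜ) ∧ ¬ HFin H (Xᶜ ∩ Y) ∧ ¬ HFin H (Xᶜ ∩ Yᶜ)

/-- Crossing of (non-trivial) almost invariant sets, quantifying over the groups over
which they are almost invariant. -/
def CrossesAny (X X' : Set G) : Prop :=
  ∃ H K : Subgroup G, NontrivAI H X ∧ NontrivAI K X' ∧ Crosses H X X'

/-- `X` and `X'` determine the same unordered pair `{[X], [X*]}` of equivalence classes. -/
def SamePair (X X' : Set G) : Prop :=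
  ∃ H : Subgroup G, NontrivAI H X ∧ (HFin H (X ∆ X') ∨ HFin H (X ∆ X'ᶜ))

/-- An admissible family of subgroups: conjugacy invariant, closed under commensurability,
and no member contains another with infinite index. -/
def Admissible (E : Set (Subgroup G)) : Prop :=
  (∀ H ∈ E, ∀ g : G, (MulAut.conj g • H) ∈ E) ∧
  (∀ H ∈ E, ∀ K : Subgroup G, Subgroup.Commensurable K H → K ∈ E) ∧
  (∀ A ∈ E, ∀ B ∈ E, A ≤ B → A.relIndex B ≠ 0)

end Group

section Tree

variable {V : Type*}

/-- The stabilizer of an edge `e : Sym2 V` under the action of `G`. -/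
def edgeStab (G : Type*) [Group G] [MulAction G V] (e : Sym2 V) : Subgroup G where
  carrier := {g | Sym2.map (g • ·) e = e}
  one_mem' := by
    show Sym2.map ((1 : G) • ·) e = e
    have : ((1 : G) • · : V → V) = id := by funext v; simp
    rw [this, Sym2.map_id]; rfl
  mul_mem' := by
    intro a b ha hb
    show Sym2.map ((a * b) • ·) e = e
    have : ((a * b) • · : V → V) = (a • ·) ∘ (b • ·) := by funext v; simp [mul_smul]
    rw [this, ← Sym2.map_map, hb, ha]
  inv_mem' := by
    intro a ha
    show Sym2.map (a⁻¹ • ·) e = e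
    conv_lhs => rw [← ha]
    rw [Sym2.map_map]
    have : ((a⁻¹ • ·) ∘ (a • ·) : V → V) = id := by funext v; simp
    rw [this, Sym2.map_id]; rfl

variable (T : SimpleGraph V)

/-- `G` acts on the graph `T` by graph automorphisms. -/
def ActsOn (G : Type*) [Group G] [MulAction G V] : Prop :=
  ∀ (g : G) (u v : V), T.Adj u v → T.Adj (g • u) (g • v)

/-- The action of `G` on `T` is without inversions. -/
def NoInversions (G : Type*) [Group G] [MulAction G V] : Prop :=
  ∀ (g : G) (u v : V), T.Adj u v → ¬ (g • u = v ∧ g • v = u)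

/-- `w` lies between `u` and `v`: it is on every path from `u` to `v`. -/
def Btw (u w v : V) : Prop := ∀ p : T.Walk u v, p.IsPath → w ∈ p.support

/-- The action of `G` on the tree `T` is minimal: every nonempty invariant subtree
(convex invariant set of vertices) is the whole vertex set. -/
def MinimalAction (G : Type*) [Group G] [MulAction G V] : Prop :=
  ∀ A : Set V, A.Nonempty → (∀ (g : G), ∀ a ∈ A, g • a ∈ A) →
    (∀ u ∈ A, ∀ v ∈ A, ∀ w : V, Btw T u w v → w ∈ A) → A = Set.univ

/-- The action of `G` is non-trivial: there is no global fixed vertex. -/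
def NontrivialAction (G : Type*) [Group G] [MulAction G V] : Prop :=
  ¬ ∃ v : V, ∀ g : G, g • v = v

/-- `T` is an `E`-tree: all edge stabilizers belong to `E`. -/
def IsETree (G : Type*) [Group G] [MulAction G V] (E : Set (Subgroup G)) : Prop :=
  ∀ e ∈ T.edgeSet, edgeStab G e ∈ E

/-- There are finitely many `G`-orbits of edges. -/
def FinEdgeOrbits (G : Type*) [Group G] [MulAction G V] : Prop :=
  ∃ F : Finset (Sym2 V), ∀ e ∈ T.edgeSet, ∃ e₀ ∈ F, ∃ g : G, Sym2.map (g • ·) e₀ = e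

/-- A cylinder of `T`: an equivalence class of edges for commensurability of stabilizers. -/
def IsCylinder (G : Type*) [Group G] [MulAction G V] (Y : Set (Sym2 V)) : Prop :=
  Y.Nonempty ∧ Y ⊆ T.edgeSet ∧
    ∀ e ∈ Y, ∀ e' ∈ T.edgeSet,
      (e' ∈ Y ↔ Subgroup.Commensurable (edgeStab G e) (edgeStab G (V := V) e'))

/-- The set of vertices of a set of edges (e.g. of a cylinder). -/
def cylVerts (Y : Set (Sym2 V)) : Set V := {v | ∃ e ∈ Y, v ∈ e}

/-- The boundary of a cylinder: its vertices lying in another cylinder,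
i.e. incident to an edge outside the cylinder. -/
def cylBoundary (Y : Set (Sym2 V)) : Set V :=
  {v | v ∈ cylVerts Y ∧ ∃ e ∈ T.edgeSet, v ∈ e ∧ e ∉ Y}

/-- `H` belongs to the commensurability class associated to the cylinder `Y`. -/
def InClassOf (G : Type*) [Group G] [MulAction G V] (Y : Set (Sym2 V)) (H : Subgroup G) : Prop :=
  ∃ e ∈ Y, Subgroup.Commensurable H (edgeStab G e)

/-- The coboundary of a set of vertices: edges with exactly one endpoint in it. -/
def cobdry (S : Set V) : Set (Sym2 V) :=
  {e | e ∈ T.edgeSet ∧ ∃ u v : V, e = s(u, v) ∧ u ∈ S ∧ v ∉ S}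

/-- `S` is a special forest based on the cylinder `Y`. -/
def IsSpecialForest (S : Set V) (Y : Set (Sym2 V)) : Prop :=
  (cobdry T S).Finite ∧ cobdry T S ⊆ Y

/-- A set of vertices is non-trivial if it is neither finite nor cofinite. -/
def NontrivForest (S : Set V) : Prop := ¬ S.Finite ∧ ¬ (Sᶜ : Set V).Finite

/-- The almost invariant set associated to a set of vertices. -/
def XS (G : Type*) [Group G] [MulAction G V] (v₀ : V) (S : Set V) : Set G :=
  {g : G | g • v₀ ∈ S}

/-- The component `T_e` of `T` minus the open edge `e = s(u,v)` containing the terminal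
vertex `v`. -/
def halfTree (u v : V) : Set V :=
  {w | ∃ p : T.Walk v w, p.IsPath ∧ s(u, v) ∉ p.edges}

/-- The almost invariant set `Z_e` dual to the oriented edge `(u, v)`. -/
def Ze (G : Type*) [Group G] [MulAction G V] (v₀ u v : V) : Set G :=
  XS G v₀ (halfTree T u v)

/-- `v` has finitely many incident edges in `Y`. -/
def FiniteValenceIn (Y : Set (Sym2 V)) (v : V) : Prop := {e | e ∈ Y ∧ v ∈ e}.Finite

/-- The peripheral special forest `S_{v,Y}`: the component of `v` in `T` minus the open
edges of `Y` incident to `v`. -/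
def periForest (Y : Set (Sym2 V)) (v : V) : Set V :=
  {w | ∃ p : T.Walk v w, p.IsPath ∧ ∀ e ∈ Y, v ∈ e → e ∉ p.edges}

/-- The peripheral almost invariant set `X_{v,Y}`. -/
def XvY (G : Type*) [Group G] [MulAction G V] (v₀ : V) (Y : Set (Sym2 V)) (v : V) : Set G :=
  XS G v₀ (periForest T Y v)

/-- A peripheral special forest: one equivalent to some `S_{v,Y}`. -/
def PeripheralForest (G : Type*) [Group G] [MulAction G V] (S : Set V) : Prop :=
  ∃ (Y : Set (Sym2 V)) (v : V), IsCylinder T G Y ∧ v ∈ cylBoundary T Y ∧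
    FiniteValenceIn Y v ∧ (S ∆ periForest T Y v).Finite

/-- The Boolean algebra `B_C(T)` of (representatives of) almost invariant sets based on the
cylinder `Y`: the smallest family containing the sets `Z_e`, `e ∈ Y`, closed under
complement, intersection and `H`-equivalence. -/
def BCT {G : Type*} [Group G] [MulAction G V] (v₀ : V) (Y : Set (Sym2 V)) (H : Subgroup G) :
    Set (Set G) :=
  ⋂₀ {F : Set (Set G) |
    (∀ u v : V, T.Adj u v → s(u, v) ∈ Y → Ze T G v₀ u v ∈ F) ∧
    (∀ X ∈ F, Xᶜ ∈ F) ∧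
    (∀ X ∈ F, ∀ X' ∈ F, X ∩ X' ∈ F) ∧
    (∀ X ∈ F, ∀ X' : Set G, HFin H (X ∆ X') → X' ∈ F)}

/-- The set `B(T)` of (representatives of) almost invariant sets based on `T`. -/
def BT (G : Type*) [Group G] [MulAction G V] (v₀ : V) : Set (Set G) :=
  {X | ∃ Y : Set (Sym2 V), IsCylinder T G Y ∧ ∃ e ∈ Y, X ∈ BCT T v₀ Y (edgeStab G e)}

/-- Elements of `B(T)` that are non-trivial almost invariant sets. -/
def NontrivB (G : Type*) [Group G] [MulAction G V] (v₀ : V) : Set (Set G) :=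
  {X | X ∈ BT T G v₀ ∧ ∃ H : Subgroup G, NontrivAI H X}

/-- One step of the relation generating cross-connected components. -/
def ccStep (G : Type*) [Group G] [MulAction G V] (v₀ : V) (X X' : Set G) : Prop :=
  X ∈ NontrivB T G v₀ ∧ X' ∈ NontrivB T G v₀ ∧ (CrossesAny X X' ∨ SamePair X X')

/-- The equivalence relation generated by crossing (and identification of equivalent sets
and complements) on `B(T)`. -/
def ccRel (G : Type*) [Group G] [MulAction G V] (v₀ : V) : Set G → Set G → Prop :=
  Relation.EqvGen (ccStep T G v₀)

/-- The cross-connected component of (the pair determined by) `X`. -/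
def ccOf (G : Type*) [Group G] [MulAction G V] (v₀ : V) (X : Set G) : Set (Set G) :=
  {X' | ccRel T G v₀ X X'}

/-- `C` is a cross-connected component of `B(T)`. -/
def IsCCC (G : Type*) [Group G] [MulAction G V] (v₀ : V) (C : Set (Set G)) : Prop :=
  ∃ X ∈ NontrivB T G v₀, C = ccOf T G v₀ X

/-- A cross-connected component is based on the cylinder `Y` if its members are almost
invariant over subgroups in the commensurability class of `Y`. -/
def CCCBasedOn (G : Type*) [Group G] [MulAction G V] (Y : Set (Sym2 V)) (C : Set (Set G)) :
    Prop :=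
  ∃ X ∈ C, ∃ H : Subgroup G, InClassOf G Y H ∧ NontrivAI H X

/-- A peripheral cross-connected component. -/
def PeripheralCCC (G : Type*) [Group G] [MulAction G V] (v₀ : V) (C : Set (Set G)) : Prop :=
  ∃ (Y : Set (Sym2 V)) (v : V), IsCylinder T G Y ∧ v ∈ cylBoundary T Y ∧
    FiniteValenceIn Y v ∧ XvY T G v₀ Y v ∈ C

/-- Betweenness of (distinct) cross-connected components. -/
def CCCBetween {G : Type*} [Group G] (C₁ C₂ C₃ : Set (Set G)) : Prop :=
  C₁ ≠ C₂ ∧ C₂ ≠ C₃ ∧ C₁ ≠ C₃ ∧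
    ∃ X₁ ∈ C₁, ∃ X₂ ∈ C₂, ∃ X₃ ∈ C₃, X₁ ⊆ X₂ ∧ X₂ ⊆ X₃

/-- A star of cross-connected components. -/
def IsStar (G : Type*) [Group G] [MulAction G V] (v₀ : V) (St : Set (Set (Set G))) : Prop :=
  (∀ C ∈ St, IsCCC T G v₀ C) ∧ St.Nontrivial ∧
  (∀ C ∈ St, ∀ C' ∈ St, ∀ C'' : Set (Set G), IsCCC T G v₀ C'' → ¬ CCCBetween C C'' C') ∧
  (∀ St' : Set (Set (Set G)), St ⊆ St' → (∀ C ∈ St', IsCCC T G v₀ C) →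
    (∀ C ∈ St', ∀ C' ∈ St', ∀ C'' : Set (Set G), IsCCC T G v₀ C'' → ¬ CCCBetween C C'' C') →
    St' = St)

/-- The regular neighbourhood `RN(B(T))`: the bipartite graph on cross-connected
components and stars. -/
def RNGraph (G : Type*) [Group G] [MulAction G V] (v₀ : V) :
    SimpleGraph ({C : Set (Set G) // IsCCC T G v₀ C} ⊕
      {St : Set (Set (Set G)) // IsStar T G v₀ St}) where
  Adj x y :=
    match x, y with
    | Sum.inl C, Sum.inr St => C.1 ∈ St.1
    | Sum.inr St, Sum.inl C => C.1 ∈ St.1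
    | _, _ => False
  symm := ⟨by rintro (C | St) (C' | St') h <;> exact h⟩
  loopless := ⟨by rintro (C | St) h <;> exact h⟩

/-- Vertices of `T` lying in at least two cylinders. -/
def TcV0 (G : Type*) [Group G] [MulAction G V] : Set V :=
  {v | ∃ Y Y' : Set (Sym2 V), IsCylinder T G Y ∧ IsCylinder T G Y' ∧ Y ≠ Y' ∧
    v ∈ cylVerts Y ∧ v ∈ cylVerts Y'}

/-- The tree of cylinders `T_c` of `T`, as a bipartite graph. -/
def TcGraph (G : Type*) [Group G] [MulAction G V] :
    SimpleGraph ({v : V // v ∈ TcV0 T G} ⊕ {Y : Set (Sym2 V) // IsCylinder T G Y}) where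
  Adj x y :=
    match x, y with
    | Sum.inl v, Sum.inr Y => v.1 ∈ cylVerts Y.1
    | Sum.inr Y, Sum.inl v => v.1 ∈ cylVerts Y.1
    | _, _ => False
  symm := ⟨by rintro (v | Y) (v' | Y') h <;> exact h⟩
  loopless := ⟨by rintro (v | Y) h <;> exact h⟩


/-- `T` dominates `T'`: there is a `G`-equivariant map. -/
def Dominates (G : Type*) [Group G] {V V' : Type*} [MulAction G V] [MulAction G V']
    (T : SimpleGraph V) (T' : SimpleGraph V') : Prop :=
  ∃ f : V → V', ∀ (g : G) (x : V), f (g • x) = g • f x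

end Tree

section Subdiv

variable {α β : Type*}

/-- `S` is a subdivision of `Γ` via the vertex embedding `f`. -/
def SubdivVia (f : α → β) (S : SimpleGraph β) (Γ : SimpleGraph α) : Prop :=
  Function.Injective f ∧
  (∀ b : β, b ∉ Set.range f → ∃ x y : β, x ≠ y ∧ S.neighborSet b = {x, y}) ∧
  (∀ u : α, Nonempty (Γ.neighborSet u ≃ S.neighborSet (f u))) ∧
  (∀ u v : α, Γ.Adj u v ↔ ∃ p : S.Walk (f u) (f v), p.IsPath ∧ 1 ≤ p.length ∧
      ∀ w ∈ p.support, w ∈ Set.range f → w = f u ∨ w = f v) ∧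
  (∀ e ∈ S.edgeSet, ∃ (u v : α) (p : S.Walk (f u) (f v)), Γ.Adj u v ∧ p.IsPath ∧
      (∀ w ∈ p.support, w ∈ Set.range f → w = f u ∨ w = f v) ∧ e ∈ p.edges)

/-- `S` is (isomorphic to) a subdivision of `Γ`. -/
def IsSubdivision (S : SimpleGraph β) (Γ : SimpleGraph α) : Prop :=
  ∃ f : α → β, SubdivVia f S Γ

end Subdiv

end SSRN

namespace SSRN

section GroupLemmas
variable {G : Type*} [Group G]

theorem hfin_iff {H : Subgroup G} {X : Set G} :
    HFin H X ↔ ∃ F : Finset G, ∀ x ∈ X, ∃ f ∈ F, ∃ h ∈ H, h * f = x := by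
  unfold HFin
  constructor
  · rintro ⟨F, hF⟩
    refine ⟨F, fun x hx => ?_⟩
    have := hF hx
    simp only [Set.mem_iUnion, Set.mem_image, SetLike.mem_coe] at this
    obtain ⟨f, hf, h, hh, e⟩ := this
    exact ⟨f, hf, h, hh, e⟩
  · rintro ⟨F, hF⟩
    refine ⟨F, fun x hx => ?_⟩
    obtain ⟨f, hf, h, hh, e⟩ := hF x hx
    simp only [Set.mem_iUnion, Set.mem_image, SetLike.mem_coe]
    exact ⟨f, hf, h, hh, e⟩

theorem HFin.mono {H : Subgroup G} {X X' : Set G} (h : HFin H X') (hs : X ⊆ X') : HFin H X := by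
  obtain ⟨F, hF⟩ := h
  exact ⟨F, hs.trans hF⟩

theorem HFin.empty (H : Subgroup G) : HFin H ∅ := ⟨∅, by simp⟩

theorem HFin.union {H : Subgroup G} {X X' : Set G} (h : HFin H X) (h' : HFin H X') :
    HFin H (X ∪ X') := by
  classical
  rw [hfin_iff] at *
  obtain ⟨F, hF⟩ := h
  obtain ⟨F', hF'⟩ := h'
  refine ⟨F ∪ F', ?_⟩
  rintro x (hx | hx)
  · obtain ⟨f, hf, r⟩ := hF x hx
    exact ⟨f, Finset.mem_union_left _ hf, r⟩
  · obtain ⟨f, hf, r⟩ := hF' x hx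
    exact ⟨f, Finset.mem_union_right _ hf, r⟩

theorem HFin.biUnion {ι : Type*} {H : Subgroup G} {s : Set ι} (hs : s.Finite) {X : ι → Set G}
    (h : ∀ i ∈ s, HFin H (X i)) : HFin H (⋃ i ∈ s, X i) := by
  induction s, hs using Set.Finite.induction_on with
  | empty => simpa using HFin.empty H
  | @insert a s ha hs ih =>
    rw [Set.biUnion_insert]
    exact (h a (Set.mem_insert _ _)).union (ih fun i hi => h i (Set.mem_insert_of_mem _ hi))

theorem HFin.rmul {H : Subgroup G} {X : Set G} (h : HFin H X) (s : G) :
    HFin H {g | g * s ∈ X} := by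
  classical
  rw [hfin_iff] at *
  obtain ⟨F, hF⟩ := h
  refine ⟨F.image (· * s⁻¹), fun x hx => ?_⟩
  obtain ⟨f, hf, k, hk, e⟩ := hF _ hx
  exact ⟨f * s⁻¹, Finset.mem_image_of_mem _ hf, k, hk, by rw [← mul_assoc, e]; group⟩

theorem HFin.coset (H : Subgroup G) (f : G) : HFin H {g | g * f⁻¹ ∈ H} := by
  rw [hfin_iff]
  exact ⟨{f}, fun x hx => ⟨f, by simp, _, hx, by group⟩⟩

theorem relIndex_of_hfin {H K : Subgroup G} {X : Set G} {f : G} (hX : HFin K X)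
    (hH : ∀ h ∈ H, h * f ∈ X) : K.relIndex H ≠ 0 := by
  classical
  rw [hfin_iff] at hX
  obtain ⟨F, hF⟩ := hX
  have key : ∀ q : H ⧸ K.subgroupOf H, ∃ j : F, ∃ k ∈ K,
      k * (j : G) = ((q.out : H) : G)⁻¹ * f := by
    intro q
    obtain ⟨j, hj, k, hk, e⟩ := hF _ (hH _ (H.inv_mem (q.out).2))
    exact ⟨⟨j, hj⟩, k, hk, e⟩
  choose φ k hk hφ using key
  have inj : Function.Injective φ := by
    intro q q' e
    rw [← Quotient.out_eq' q, ← Quotient.out_eq' q']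
    apply Quotient.sound'
    rw [QuotientGroup.leftRel_apply, Subgroup.mem_subgroupOf]
    have h1 := hφ q
    have h2 := hφ q'
    rw [← e] at h2
    have : ((q.out : H) : G)⁻¹ * ((q'.out : H) : G) = k q * (k q')⁻¹ := by
      have a1 : ((q.out : H) : G)⁻¹ = k q * (φ q : G) * f⁻¹ := by rw [h1]; group
      have a2 : ((q'.out : H) : G)⁻¹ = k q' * (φ q : G) * f⁻¹ := by rw [h2]; group
      have a3 : ((q'.out : H) : G) = (k q' * (φ q : G) * f⁻¹)⁻¹ := by rw [← a2]; group
      rw [a1, a3]; group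
    show ((q.out : H) : G)⁻¹ * ((q'.out : H) : G) ∈ K
    rw [this]
    exact K.mul_mem (hk q) (K.inv_mem (hk q'))
  have : Finite (H ⧸ K.subgroupOf H) := Finite.of_injective φ inj
  exact Subgroup.index_ne_zero_of_finite

theorem hfin_of_relIndex {H K : Subgroup G} (h : K.relIndex H ≠ 0) : HFin K (H : Set G) := by
  classical
  have hfi : (K.subgroupOf H).FiniteIndex := ⟨h⟩
  have : Finite (H ⧸ K.subgroupOf H) := inferInstance
  have := Fintype.ofFinite (H ⧸ K.subgroupOf H)
  rw [hfin_iff]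
  refine ⟨Finset.univ.image (fun q : H ⧸ K.subgroupOf H => ((q.out : H) : G)⁻¹), fun x hx => ?_⟩
  set q : H ⧸ K.subgroupOf H := QuotientGroup.mk (⟨x, hx⟩⁻¹ : H) with hq
  refine ⟨_, Finset.mem_image_of_mem _ (Finset.mem_univ q), x * ((q.out : H) : G), ?_, by group⟩
  have : QuotientGroup.mk (q.out) = (QuotientGroup.mk (⟨x, hx⟩⁻¹ : H) : H ⧸ K.subgroupOf H) := by
    rw [QuotientGroup.out_eq']
  have := QuotientGroup.eq.1 this.symm
  rw [Subgroup.mem_subgroupOf] at this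
  simpa using this

theorem HFin.of_relIndex {H K : Subgroup G} {X : Set G} (hX : HFin H X) (h : K.relIndex H ≠ 0) :
    HFin K X := by
  have hH := hfin_of_relIndex h
  obtain ⟨F, hF⟩ := hfin_iff.1 hX
  have : HFin K (⋃ f ∈ (F : Set G), {g | g * f⁻¹ ∈ (H : Set G)}) :=
    HFin.biUnion F.finite_toSet (fun f _ => hH.rmul f⁻¹)
  refine this.mono fun x hx => ?_
  obtain ⟨f, hf, k, hk, e⟩ := hF x hx
  simp only [Set.mem_iUnion]
  refine ⟨f, hf, ?_⟩
  show x * f⁻¹ ∈ (H : Set G)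
  rw [← e]
  simpa using hk

theorem HFin.comm {H K : Subgroup G} {X : Set G} (hX : HFin H X)
    (h : Subgroup.Commensurable K H) : HFin K X := hX.of_relIndex h.1

theorem hfin_symmDiff_trans {H : Subgroup G} {A B C : Set G} (h : HFin H (A ∆ B))
    (h' : HFin H (B ∆ C)) : HFin H (A ∆ C) :=
  (h.union h').mono (symmDiff_triangle A B C)

theorem symmDiff_compl_compl' (A B : Set G) : Aᶜ ∆ Bᶜ = A ∆ B := by
  ext x; simp only [Set.mem_symmDiff, Set.mem_compl_iff]; tauto

/-- The set of elements where membership in `X` changes under right multiplication by `t`. -/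
def Dif (X : Set G) (t : G) : Set G := {g | ¬ (g ∈ X ↔ g * t ∈ X)}

theorem IsAI.dif {H : Subgroup G} {X : Set G} (h : IsAI H X) (t : G) : HFin H (Dif X t) := by
  refine (h.2 t⁻¹).mono fun g hg => ?_
  have : g ∈ (· * t⁻¹) '' X ↔ g * t ∈ X := by
    constructor
    · rintro ⟨x, hx, rfl⟩; simpa using hx
    · intro hx; exact ⟨_, hx, by simp⟩
  rw [Set.mem_symmDiff, this]
  simp only [Dif, Set.mem_setOf_eq] at hg
  tauto

theorem isAI_of_dif {H : Subgroup G} {X : Set G} (h1 : ∀ h ∈ H, ∀ x, h * x ∈ X ↔ x ∈ X)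
    (h2 : ∀ t, HFin H (Dif X t)) : IsAI H X := by
  constructor
  · intro h hh
    ext x
    constructor
    · rintro ⟨y, hy, rfl⟩; exact (h1 h hh y).2 hy
    · intro hx
      exact ⟨h⁻¹ * x, (h1 _ (H.inv_mem hh) x).2 hx, by simp⟩
  · intro s
    refine (h2 s⁻¹).mono fun g hg => ?_
    have : g ∈ (· * s) '' X ↔ g * s⁻¹ ∈ X := by
      constructor
      · rintro ⟨x, hx, rfl⟩; simpa using hx
      · intro hx; exact ⟨_, hx, by simp⟩
    rw [Set.mem_symmDiff, this] at hg
    simp only [Dif, Set.mem_setOf_eq]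
    tauto

theorem IsAI.inv {H : Subgroup G} {X : Set G} (h : IsAI H X) {k : G} (hk : k ∈ H) (x : G) :
    k * x ∈ X ↔ x ∈ X := by
  have e := h.1 k hk
  constructor
  · intro hx
    rw [← e] at hx
    obtain ⟨y, hy, e'⟩ := hx
    have : y = x := mul_left_cancel e'
    rwa [← this]
  · intro hx
    rw [← e]
    exact ⟨x, hx, rfl⟩

theorem IsAI.compl {H : Subgroup G} {X : Set G} (h : IsAI H X) : IsAI H Xᶜ := by
  refine isAI_of_dif (fun k hk x => not_congr (h.inv hk x)) fun t => ?_
  refine (h.dif t).mono fun g hg => ?_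
  simp only [Dif, Set.mem_setOf_eq, Set.mem_compl_iff] at *
  tauto

theorem NontrivAI.compl {H : Subgroup G} {X : Set G} (h : NontrivAI H X) : NontrivAI H Xᶜ :=
  ⟨h.1.compl, h.2.2, by rw [compl_compl]; exact h.2.1⟩

theorem NontrivAI.exists_dif {H : Subgroup G} {X : Set G} (h : NontrivAI H X) :
    ∃ t g, g ∈ Dif X t := by
  have h1 : X.Nonempty := by
    by_contra hc
    rw [Set.not_nonempty_iff_eq_empty] at hc
    exact h.2.1 (hc ▸ HFin.empty H)
  have h2 : Xᶜ.Nonempty := by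
    by_contra hc
    rw [Set.not_nonempty_iff_eq_empty] at hc
    exact h.2.2 (hc ▸ HFin.empty H)
  obtain ⟨x, hx⟩ := h1
  obtain ⟨y, hy⟩ := h2
  refine ⟨x⁻¹ * y, x, ?_⟩
  simp only [Dif, Set.mem_setOf_eq, mul_inv_cancel_left]
  intro hc
  exact hy (hc.1 hx)

theorem CrossesAny.compl_left {X X' : Set G} (h : CrossesAny X X') : CrossesAny Xᶜ X' := by
  obtain ⟨H, K, h1, h2, h3⟩ := h
  refine ⟨H, K, h1.compl, h2, ?_⟩
  unfold Crosses at *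
  rw [compl_compl]
  tauto

theorem CrossesAny.compl_right {X X' : Set G} (h : CrossesAny X X') : CrossesAny X X'ᶜ := by
  obtain ⟨H, K, h1, h2, h3⟩ := h
  refine ⟨H, K, h1, h2.compl, ?_⟩
  unfold Crosses at *
  rw [compl_compl]
  tauto

end GroupLemmas

section GraphLemmas
variable {V : Type*} {T : SimpleGraph V}

theorem cob_iff {S : Set V} {x y : V} (h : T.Adj x y) :
    s(x, y) ∈ cobdry T S ↔ ¬ (x ∈ S ↔ y ∈ S) := by
  unfold cobdry
  simp only [Set.mem_setOf_eq, SimpleGraph.mem_edgeSet]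
  constructor
  · rintro ⟨_, u, v, e, hu, hv⟩
    rcases Sym2.eq_iff.1 e with ⟨rfl, rfl⟩ | ⟨rfl, rfl⟩ <;> tauto
  · intro hne
    refine ⟨h, ?_⟩
    by_cases hx : x ∈ S
    · exact ⟨x, y, rfl, hx, by tauto⟩
    · exact ⟨y, x, Sym2.eq_swap, by tauto, hx⟩

theorem cobdry_edge {S : Set V} {e : Sym2 V} (h : e ∈ cobdry T S) : e ∈ T.edgeSet := h.1

theorem walk_iff {S : Set V} {c d : V} (p : T.Walk c d) (hp : ∀ e ∈ p.edges, e ∉ cobdry T S) :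
    c ∈ S ↔ d ∈ S := by
  induction p with
  | nil => exact Iff.rfl
  | @cons u v w h p ih =>
    simp only [SimpleGraph.Walk.edges_cons, List.mem_cons, forall_eq_or_imp] at hp
    have h1 := hp.1
    rw [cob_iff h, not_not] at h1
    exact h1.trans (ih hp.2)

theorem eq_of_cob (hc : T.Connected) {S S' : Set V}
    (h : ∀ x y, T.Adj x y → ((x ∈ S ↔ y ∈ S) ↔ (x ∈ S' ↔ y ∈ S'))) {a : V}
    (ha : a ∈ S ↔ a ∈ S') : S = S' := by
  ext w
  obtain ⟨p⟩ := hc a w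
  induction p with
  | nil => exact ha
  | @cons u v w hh p ih =>
    apply ih
    have := h _ _ hh
    tauto

theorem eq_empty_of_cob (hc : T.Connected) {S : Set V}
    (h : ∀ x y, T.Adj x y → (x ∈ S ↔ y ∈ S)) {a : V} (ha : a ∉ S) : S = ∅ :=
  eq_of_cob hc (fun x y hxy => by simp [h x y hxy]) (a := a) (by simpa using ha)

theorem ht_right (u v : V) : v ∈ halfTree T u v := ⟨.nil, by simp, by simp⟩

theorem path_eq (hT : T.IsTree) {u v : V} {p q : T.Walk u v} (hp : p.IsPath) (hq : q.IsPath) :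
    p = q := by
  have := hT.2.path_unique ⟨p, hp⟩ ⟨q, hq⟩
  exact congrArg Subtype.val this

theorem ht_left (hT : T.IsTree) {u v : V} (h : T.Adj u v) : u ∉ halfTree T u v := by
  rintro ⟨p, hp, he⟩
  have : p = SimpleGraph.Walk.cons h.symm .nil := path_eq hT hp (by simp [h.ne'])
  rw [this] at he
  simp at he

theorem ht_step {u v x y : V} (hxy : T.Adj x y) (hne : s(x, y) ≠ s(u, v))
    (hx : x ∈ halfTree T u v) : y ∈ halfTree T u v := by
  classical
  obtain ⟨p, hp, he⟩ := hx
  refine ⟨(p.concat hxy).bypass, SimpleGraph.Walk.bypass_isPath _, fun hc => ?_⟩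
  have := SimpleGraph.Walk.edges_bypass_subset_edges _ hc
  rw [SimpleGraph.Walk.edges_concat] at this
  simp only [List.concat_eq_append, List.mem_append, List.mem_singleton] at this
  rcases this with h | h
  · exact he h
  · exact hne h.symm

theorem ht_iff {u v x y : V} (hxy : T.Adj x y) (hne : s(x, y) ≠ s(u, v)) :
    x ∈ halfTree T u v ↔ y ∈ halfTree T u v :=
  ⟨ht_step hxy hne, ht_step hxy.symm (by rwa [Sym2.eq_swap])⟩

theorem ht_cob (hT : T.IsTree) {u v : V} (h : T.Adj u v) :
    cobdry T (halfTree T u v) = {s(u, v)} := by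
  ext e
  constructor
  · intro he
    induction e using Sym2.ind with
    | _ x y =>
      by_contra hne
      exact (cob_iff (cobdry_edge he)).1 he (ht_iff (cobdry_edge he) hne)
  · rintro rfl
    rw [cob_iff h]
    have := ht_left hT h
    have := ht_right (T := T) u v
    tauto

theorem ht_adj (hT : T.IsTree) {u v x y : V} (h : T.Adj u v) (hxy : T.Adj x y)
    (hx : x ∉ halfTree T u v) (hy : y ∈ halfTree T u v) : x = u ∧ y = v := by
  have : s(x, y) = s(u, v) := by
    by_contra hne
    exact hx ((ht_iff hxy hne).2 hy)
  rcases Sym2.eq_iff.1 this with h' | ⟨rfl, rfl⟩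
  · exact h'
  · exact absurd (ht_right _ _) hx

theorem ht_compl (hT : T.IsTree) {u v : V} (h : T.Adj u v) :
    halfTree T v u = (halfTree T u v)ᶜ := by
  refine eq_of_cob hT.1 (a := u) (fun x y hxy => ?_) ?_
  · have h1 : s(x, y) ∈ cobdry T (halfTree T u v) ↔ s(x, y) ∈ cobdry T (halfTree T v u) := by
      rw [ht_cob hT h, ht_cob hT h.symm, Sym2.eq_swap]
    rw [cob_iff hxy, cob_iff hxy] at h1
    simp only [Set.mem_compl_iff]
    tauto
  · have := ht_left hT h
    have := ht_right (T := T) v u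
    simp only [Set.mem_compl_iff]
    tauto

theorem ht_sub (hT : T.IsTree) {x y z : V} (hxy : T.Adj x y) (hyz : T.Adj y z) (hne : z ≠ x) :
    halfTree T y z ⊆ halfTree T x y := by
  have hs : s(x, y) ≠ s(y, z) := by
    intro hc
    rcases Sym2.eq_iff.1 hc with ⟨rfl, _⟩ | ⟨e, _⟩
    · exact hxy.ne rfl
    · exact hne e.symm
  have hx : x ∉ halfTree T y z := fun hc => ht_left hT hyz ((ht_iff hxy hs).1 hc)
  have hz : z ∈ halfTree T x y := (ht_iff hyz hs.symm).1 (ht_right _ _)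
  have : halfTree T y z ∩ (halfTree T x y)ᶜ = ∅ := by
    refine eq_empty_of_cob hT.1 (a := x) (fun c d hcd => ?_) (fun hc => hx hc.1)
    by_cases h1 : s(c, d) = s(y, z)
    · have : c ∈ halfTree T x y ∧ d ∈ halfTree T x y := by
        rcases Sym2.eq_iff.1 h1 with ⟨rfl, rfl⟩ | ⟨rfl, rfl⟩
        · exact ⟨ht_right _ _, hz⟩
        · exact ⟨hz, ht_right _ _⟩
      simp [this.1, this.2]
    · have e1 := ht_iff hcd h1
      by_cases h2 : s(c, d) = s(x, y)
      · have : c ∉ halfTree T y z ∧ d ∉ halfTree T y z := by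
          rcases Sym2.eq_iff.1 h2 with ⟨rfl, rfl⟩ | ⟨rfl, rfl⟩
          · exact ⟨hx, ht_left hT hyz⟩
          · exact ⟨ht_left hT hyz, hx⟩
        simp [this.1, this.2]
      · have e2 := ht_iff hcd h2
        simp only [Set.mem_inter_iff, Set.mem_compl_iff]
        tauto
  intro w hw
  by_contra hc
  have : w ∈ (∅ : Set V) := this ▸ ⟨hw, hc⟩
  exact this

theorem ht_disj (hT : T.IsTree) {y z z' : V} (hz : T.Adj y z) (hz' : T.Adj y z') (hne : z ≠ z')
    {w : V} (h1 : w ∈ halfTree T y z) (h2 : w ∈ halfTree T y z') : False := by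
  have h3 := ht_sub hT hz.symm hz' hne.symm h2
  rw [ht_compl hT hz] at h3
  exact h3 h1

theorem ht_dist (hT : T.IsTree) {y z a w : V} (hyz : T.Adj y z) (ha : a ∉ halfTree T y z)
    (hw : w ∈ halfTree T y z) : T.dist a y + 1 ≤ T.dist a w := by
  obtain ⟨p, hp⟩ := hT.1.exists_walk_length_eq_dist a w
  rw [← hp]
  clear hp
  induction p with
  | nil => exact absurd hw ha
  | @cons u v w h p ih =>
    rw [SimpleGraph.Walk.length_cons]
    by_cases hv : v ∈ halfTree T y z
    · obtain ⟨rfl, _⟩ := ht_adj hT hyz h ha hv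
      simp
    · have := ih hv hw
      have h3 := hT.1.dist_triangle (u := u) (v := v) (w := y)
      have h4 : T.dist u v = 1 := SimpleGraph.dist_eq_one_iff_adj.2 h
      omega

end GraphLemmas

end SSRN
namespace SSRN

/-- The standing hypotheses. -/
structure Ctx (G : Type*) {V : Type*} [Group G] [MulAction G V] (T : SimpleGraph V)
    (E : Set (Subgroup G)) : Prop where
  hT : T.IsTree
  hact : ActsOn T G
  hinv : NoInversions T G
  hE : Admissible E
  hET : IsETree T G E
  hmin : MinimalAction T G
  hval3 : ∀ w : V, ∃ a b c : V, a ≠ b ∧ a ≠ c ∧ b ≠ c ∧ T.Adj w a ∧ T.Adj w b ∧ T.Adj w c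

section CtxLemmas
variable {G V : Type*} [Group G] [MulAction G V] {T : SimpleGraph V} {E : Set (Subgroup G)}
  {Y : Set (Sym2 V)}

theorem Ctx.adj_iff (c : Ctx G T E) (g : G) {u v : V} : T.Adj (g • u) (g • v) ↔ T.Adj u v := by
  constructor
  · intro h
    have := c.hact g⁻¹ _ _ h
    simpa using this
  · exact c.hact g u v

theorem Ctx.dist_le (c : Ctx G T E) (g : G) (u v : V) : T.dist (g • u) (g • v) ≤ T.dist u v := by
  obtain ⟨p, hp⟩ := c.hT.1.exists_walk_length_eq_dist u v
  let φ : T →g T := ⟨(g • ·), fun {a b} h => c.hact g a b h⟩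
  have := SimpleGraph.dist_le (p.map φ)
  rw [SimpleGraph.Walk.length_map, hp] at this
  exact this

theorem Ctx.dist_smul (c : Ctx G T E) (g : G) (u v : V) :
    T.dist (g • u) (g • v) = T.dist u v := by
  apply le_antisymm (c.dist_le g u v)
  have := c.dist_le g⁻¹ (g • u) (g • v)
  simpa using this

theorem mem_edgeStab {g : G} {e : Sym2 V} : g ∈ edgeStab G e ↔ Sym2.map (g • ·) e = e := Iff.rfl

theorem Ctx.fix (c : Ctx G T E) {g : G} {u v : V} (h : T.Adj u v)
    (hg : g ∈ edgeStab G s(u, v)) : g • u = u ∧ g • v = v := by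
  rw [mem_edgeStab, Sym2.map_mk] at hg
  rcases Sym2.eq_iff.1 hg with h' | h'
  · exact h'
  · exact absurd h' (c.hinv g u v h)

theorem Ctx.fix_mem (c : Ctx G T E) {g : G} {e : Sym2 V} (h : e ∈ T.edgeSet)
    (hg : g ∈ edgeStab G e) {u : V} (hu : u ∈ e) : g • u = u := by
  induction e using Sym2.ind with
  | _ x y =>
    have := c.fix h hg
    rcases Sym2.mem_iff.1 hu with rfl | rfl
    · exact this.1
    · exact this.2

theorem map_smul_inj (g : G) : Function.Injective (Sym2.map (g • · : V → V)) :=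
  Sym2.map.injective (MulAction.injective g)

theorem cob_smul (c : Ctx G T E) {g : G} {S : Set V} {f : Sym2 V}
    (hf : f ∈ cobdry T {w | g • w ∈ S}) : Sym2.map (g • ·) f ∈ cobdry T S := by
  induction f using Sym2.ind with
  | _ x y =>
    have h1 : T.Adj x y := cobdry_edge hf
    rw [cob_iff h1] at hf
    rw [Sym2.map_mk, cob_iff ((c.adj_iff g).2 h1)]
    exact hf

theorem Ctx.path_fix (c : Ctx G T E) {g : G} {x w : V} (hx : g • x = x) (hw : g • w = w)
    (p : T.Walk x w) (hp : p.IsPath) {u : V} (hu : u ∈ p.support) : g • u = u := by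
  let φ : T →g T := ⟨(g • ·), fun {a b} h => c.hact g a b h⟩
  have hφ : Function.Injective φ := MulAction.injective g
  let q : T.Walk x w := (p.map φ).copy hx hw
  have hq : q.IsPath := by
    simp only [q, SimpleGraph.Walk.isPath_copy]
    exact SimpleGraph.Walk.map_isPath_of_injective hφ hp
  have e : q = p := path_eq c.hT hq hp
  have e2 : p.support.map φ = p.support := by
    have : q.support = p.support.map φ := by simp [q]
    rw [← this, e]
  have e3 : p.support.map φ = p.support.map id := by rw [e2, List.map_id]
  exact List.map_inj_left.1 e3 u hu

theorem IsCylinder.eq {Y' : Set (Sym2 V)} (hY : IsCylinder T G Y) (hY' : IsCylinder T G Y')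
    {e e' : Sym2 V} (he : e ∈ Y) (he' : e' ∈ Y')
    (h : Subgroup.Commensurable (edgeStab G e) (edgeStab G e')) : Y = Y' := by
  ext f
  constructor
  · intro hf
    have h1 := (hY.2.2 e he f (hY.2.1 hf)).1 hf
    exact (hY'.2.2 e' he' f (hY.2.1 hf)).2 (h.symm.trans h1)
  · intro hf
    have h1 := (hY'.2.2 e' he' f (hY'.2.1 hf)).1 hf
    exact (hY.2.2 e he f (hY'.2.1 hf)).2 (h.trans h1)

theorem IsCylinder.comm (hY : IsCylinder T G Y) {e e' : Sym2 V} (he : e ∈ Y) (he' : e' ∈ Y) :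
    Subgroup.Commensurable (edgeStab G e) (edgeStab G e') :=
  (hY.2.2 e he e' (hY.2.1 he')).1 he'

theorem comm_inf {H K L : Subgroup G} (h : Subgroup.Commensurable K H)
    (h' : Subgroup.Commensurable L H) : Subgroup.Commensurable (K ⊓ L) H := by
  refine ⟨Subgroup.relIndex_inf_ne_zero h.1 h'.1, ?_⟩
  exact Subgroup.relIndex_ne_zero_trans (K := K) h.2
    (by rw [Subgroup.relIndex_eq_one.2 inf_le_left]; exact one_ne_zero)

theorem Ctx.cyl_path (c : Ctx G T E) (hY : IsCylinder T G Y) {x w : V} (hx : x ∈ cylVerts Y)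
    (hw : w ∈ cylVerts Y) (p : T.Walk x w) (hp : p.IsPath) {f : Sym2 V} (hf : f ∈ p.edges) :
    f ∈ Y := by
  obtain ⟨e, he, hxe⟩ := hx
  obtain ⟨e', he', hwe⟩ := hw
  have hfe : f ∈ T.edgeSet := p.edges_subset_edgeSet hf
  refine (hY.2.2 e he f hfe).2 ?_
  set K := edgeStab G e ⊓ edgeStab G e' with hK
  have hKc : Subgroup.Commensurable K (edgeStab G e) :=
    comm_inf (Subgroup.Commensurable.refl _) (hY.comm he' he)
  have hKE : K ∈ E := c.hE.2.1 _ (c.hET e (hY.2.1 he)) K hKc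
  have hKf : K ≤ edgeStab G f := by
    intro g hg
    have h1 := c.fix_mem (hY.2.1 he) hg.1 hxe
    have h2 := c.fix_mem (hY.2.1 he') hg.2 hwe
    induction f using Sym2.ind with
    | _ u v =>
      rw [mem_edgeStab, Sym2.map_mk,
        c.path_fix h1 h2 p hp (p.fst_mem_support_of_mem_edges hf),
        c.path_fix h1 h2 p hp (p.snd_mem_support_of_mem_edges hf)]
  have h3 := c.hE.2.2 K hKE _ (c.hET f hfe) hKf
  exact hKc.symm.trans ⟨h3, by rw [Subgroup.relIndex_eq_one.2 hKf]; exact one_ne_zero⟩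

theorem Ctx.cyl_path_support (c : Ctx G T E) (hY : IsCylinder T G Y) {x w : V}
    (hx : x ∈ cylVerts Y)
    (hw : w ∈ cylVerts Y) (p : T.Walk x w) (hp : p.IsPath) {f : V} (hf : f ∈ p.support) :
    f ∈ cylVerts Y := by
  by_cases hn : p.Nil
  · cases p with
    | nil =>
      rw [SimpleGraph.Walk.support_nil, List.mem_singleton] at hf
      rwa [hf]
    | cons h p => simp at hn
  · rw [SimpleGraph.Walk.mem_support_iff_exists_mem_edges_of_not_nil hn] at hf
    obtain ⟨e, he, hfe⟩ := hf
    exact ⟨e, c.cyl_path hY hx hw p hp he, hfe⟩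

theorem exists_path (hT : T.IsTree) (x w : V) : ∃ p : T.Walk x w, p.IsPath := by
  classical
  obtain ⟨p⟩ := hT.1 x w
  exact ⟨p.bypass, p.bypass_isPath⟩

theorem Ctx.nbrs (c : Ctx G T E) (x y : V) :
    ∃ z z', z ≠ z' ∧ z ≠ x ∧ z' ≠ x ∧ T.Adj y z ∧ T.Adj y z' := by
  obtain ⟨a, b, d, h1, h2, h3, h4, h5, h6⟩ := c.hval3 y
  by_cases ha : a = x
  · subst ha
    exact ⟨b, d, h3, h1.symm, h2.symm, h5, h6⟩
  · by_cases hb : b = x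
    · subst hb
      exact ⟨a, d, h2, h1, h3.symm, h4, h6⟩
    · exact ⟨a, b, h1, ha, hb, h4, h5⟩

theorem Ctx.far (c : Ctx G T E) {x y : V} (h : T.Adj x y) (a : V) (R : ℕ) :
    ∃ x' y', T.Adj x' y' ∧ halfTree T x' y' ⊆ halfTree T x y ∧ a ∉ halfTree T x' y' ∧
      ∀ w ∈ halfTree T x' y', R < T.dist a w := by
  induction R with
  | zero =>
    obtain ⟨z, z', hzz, hzx, hzx', hz, hz'⟩ := c.nbrs x y
    have key : ∀ z, T.Adj y z → z ≠ x → a ∉ halfTree T y z →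
        ∃ x' y', T.Adj x' y' ∧ halfTree T x' y' ⊆ halfTree T x y ∧ a ∉ halfTree T x' y' ∧
      ∀ w ∈ halfTree T x' y', 0 < T.dist a w := by
      intro z hz hzx ha
      refine ⟨y, z, hz, ht_sub c.hT h hz hzx, ha, fun w hw => ?_⟩
      have := ht_dist c.hT hz ha hw
      omega
    by_cases ha : a ∈ halfTree T y z
    · exact key z' hz' hzx' (fun h2 => ht_disj c.hT hz hz' hzz ha h2)
    · exact key z hz hzx ha
  | succ R ih =>
    obtain ⟨x', y', h1, h2, h3, h4⟩ := ih
    obtain ⟨z, _, _, hzx, _, hz, _⟩ := c.nbrs x' y'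
    have hs := ht_sub c.hT h1 hz hzx
    refine ⟨y', z, hz, hs.trans h2, fun hc => h3 (hs hc), fun w hw => ?_⟩
    have := ht_dist c.hT hz (fun hc => h3 (hs hc)) hw
    have := h4 y' (ht_right _ _)
    omega

theorem Ctx.ht_infinite (c : Ctx G T E) {x y : V} (h : T.Adj x y) :
    (halfTree T x y).Infinite := by
  intro hf
  obtain ⟨M, hM⟩ := (hf.image (T.dist x)).bddAbove
  obtain ⟨x', y', h1, h2, h3, h4⟩ := c.far h x M
  have h5 := h4 y' (ht_right _ _)
  have h6 := hM ⟨y', h2 (ht_right _ _), rfl⟩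
  omega

theorem exists_cob {S : Set V} {a b : V} (p : T.Walk a b) (h : ¬ (a ∈ S ↔ b ∈ S)) :
    ∃ e ∈ p.edges, e ∈ cobdry T S := by
  by_contra hc
  push Not at hc
  exact h (walk_iff p hc)

theorem Ctx.orbit (c : Ctx G T E) {x y : V} (h : T.Adj x y) (u : V) :
    ∃ g : G, g • u ∈ halfTree T x y := by
  classical
  by_contra hc
  push Not at hc
  have := c.hmin {w | ∀ g : G, g • w ∉ halfTree T x y} ⟨u, hc⟩ ?_ ?_
  · have hy : y ∈ {w | ∀ g : G, g • w ∉ halfTree T x y} := this ▸ Set.mem_univ y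
    exact hy 1 (by rw [one_smul]; exact ht_right _ _)
  · intro g a ha g'
    rw [smul_smul]
    exact ha _
  · intro a ha b hb w hw g hgw
    obtain ⟨p, hp⟩ := exists_path c.hT a b
    have hwp := hw p hp
    have ha' : a ∉ {w | g • w ∈ halfTree T x y} := ha g
    have hb' : b ∉ {w | g • w ∈ halfTree T x y} := hb g
    have hw' : w ∈ {w | g • w ∈ halfTree T x y} := hgw
    obtain ⟨e, he, he'⟩ := exists_cob (p.takeUntil w hwp)
      (S := {w | g • w ∈ halfTree T x y}) (by tauto)
    obtain ⟨f, hf, hf'⟩ := exists_cob (p.dropUntil w hwp)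
      (S := {w | g • w ∈ halfTree T x y}) (by tauto)
    have h1 := cob_smul c he'
    have h2 := cob_smul c hf'
    rw [ht_cob c.hT h, Set.mem_singleton_iff] at h1 h2
    have hef : e = f := map_smul_inj g (h1.trans h2.symm)
    have hnd := hp.isTrail.edges_nodup
    rw [← p.take_spec hwp, SimpleGraph.Walk.edges_append] at hnd
    exact (List.nodup_append.1 hnd).2.2 e he f hf hef

theorem sym2_finite (e : Sym2 V) : {x | x ∈ e}.Finite := by
  induction e using Sym2.ind with
  | _ x y =>
    refine (Set.toFinite {x, y}).subset fun z hz => ?_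
    simpa using hz

theorem Ctx.hang (c : Ctx G T E) (hY : IsCylinder T G Y) {S : Set V}
    (hS : IsSpecialForest T S Y) :
    ∃ W : Set V, W.Finite ∧ W ⊆ cylVerts Y ∧
      (∀ u v, T.Adj u v → u ∉ W → (u ∈ S ↔ v ∈ S)) ∧
      (∀ w, w ∉ W → ∃ x ∈ W, ∃ y, y ∉ W ∧ T.Adj x y ∧ w ∈ halfTree T x y) ∧
      (∀ x ∈ W, ∀ y, y ∉ W → T.Adj x y → (∀ z ∈ W, z ∉ halfTree T x y) ∧
        ∀ z ∈ halfTree T x y, (z ∈ S ↔ y ∈ S)) := by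
  classical
  obtain ⟨e₀, he₀⟩ := hY.1
  obtain ⟨a, hae⟩ : ∃ a, a ∈ e₀ := by
    induction e₀ using Sym2.ind with
    | _ x y => exact ⟨x, by simp⟩
  have ha : a ∈ cylVerts Y := ⟨e₀, he₀, hae⟩
  choose q hq using fun p => exists_path c.hT a p
  set P : Set V := {a} ∪ ⋃ e ∈ cobdry T S, {x | x ∈ e} with hP
  have hPf : P.Finite := (Set.finite_singleton a).union
    (hS.1.biUnion fun e _ => sym2_finite e)
  have hPY : P ⊆ cylVerts Y := by
    rintro x (rfl | hx)
    · exact ha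
    · simp only [Set.mem_iUnion] at hx
      obtain ⟨e, he, hxe⟩ := hx
      exact ⟨e, hS.2 he, hxe⟩
  set W : Set V := ⋃ p ∈ P, {w | w ∈ (q p).support} with hW
  have hPW : P ⊆ W := by
    intro p hp
    rw [hW]
    simp only [Set.mem_iUnion]
    exact ⟨p, hp, (q p).end_mem_support⟩
  have haW : a ∈ W := hPW (Or.inl rfl)
  have hWS : ∀ u v, T.Adj u v → u ∉ W → (u ∈ S ↔ v ∈ S) := by
    intro u v huv hu
    by_contra hne
    rw [← cob_iff huv] at hne
    apply hu
    apply hPW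
    right
    simp only [Set.mem_iUnion]
    exact ⟨_, hne, by simp⟩
  have hWht : ∀ x ∈ W, ∀ y, y ∉ W → T.Adj x y → ∀ z ∈ W, z ∉ halfTree T x y := by
    intro x hx y hy hxy
    have key : ∀ z ∈ W, (a ∈ halfTree T x y ↔ z ∈ halfTree T x y) := by
      intro z hz
      rw [hW] at hz
      simp only [Set.mem_iUnion] at hz
      obtain ⟨p, hp, hzp⟩ := hz
      apply walk_iff ((q p).takeUntil z hzp)
      intro e he he'
      rw [ht_cob c.hT hxy, Set.mem_singleton_iff] at he'
      subst he'
      apply hy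
      rw [hW]
      simp only [Set.mem_iUnion]
      exact ⟨p, hp, (q p).snd_mem_support_of_mem_edges
        ((q p).edges_takeUntil_subset_edges hzp he)⟩
    intro z hz hc
    exact ht_left c.hT hxy ((key x hx).1 ((key z hz).2 hc))
  refine ⟨W, ?_, ?_, hWS, ?_, ?_⟩
  · exact hPf.biUnion fun p _ => List.finite_toSet (q p).support
  · intro w hw
    rw [hW] at hw
    simp only [Set.mem_iUnion] at hw
    obtain ⟨p, hp, hwp⟩ := hw
    exact c.cyl_path_support hY ha (hPY hp) (q p) (hq p) hwp
  · intro w hw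
    obtain ⟨p⟩ := c.hT.1 w a
    clear_value W
    clear hW hWht hWS hPW hPY hP hPf hq q P hae ha
    induction p with
    | nil => exact absurd haW hw
    | @cons u v d h p ih =>
      by_cases hv : v ∈ W
      · exact ⟨v, hv, u, hw, h.symm, ht_right _ _⟩
      · obtain ⟨x, hx, y, hy, hxy, hvh⟩ := ih haW hv
        refine ⟨x, hx, y, hy, hxy, ?_⟩
        refine ht_step h.symm (fun hc => ?_) hvh
        rcases Sym2.eq_iff.1 hc with ⟨rfl, _⟩ | ⟨_, rfl⟩
        · exact hv hx
        · exact hw hx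
  · intro x hx y hy hxy
    have h1 := hWht x hx y hy hxy
    refine ⟨h1, ?_⟩
    have key : ∀ S' : Set V, (∀ u v, T.Adj u v → u ∉ W → (u ∈ S' ↔ v ∈ S')) → y ∉ S' →
        ∀ z ∈ halfTree T x y, z ∉ S' := by
      intro S' hS' hyS z hz hzS
      have : halfTree T x y ∩ S' = ∅ := by
        refine eq_empty_of_cob c.hT.1 (a := x) (fun u v huv => ?_)
          (fun hc => ht_left c.hT hxy hc.1)
        by_cases hs : s(u, v) = s(x, y)
        · have := ht_left c.hT hxy
          rcases Sym2.eq_iff.1 hs with ⟨rfl, rfl⟩ | ⟨rfl, rfl⟩ <;>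
          · simp only [Set.mem_inter_iff]
            tauto
        · have e1 := ht_iff huv hs
          by_cases hu : u ∈ halfTree T x y
          · have := hS' u v huv (fun hc => h1 u hc hu)
            simp only [Set.mem_inter_iff]
            tauto
          · simp only [Set.mem_inter_iff]
            tauto
      have h2 : z ∈ (∅ : Set V) := this ▸ ⟨hz, hzS⟩
      exact h2
    intro z hz
    by_cases hyS : y ∈ S
    · have := key Sᶜ (fun u v huv hu => not_congr (hWS u v huv hu)) (by simpa using hyS) z hz
      simp only [Set.mem_compl_iff, not_not] at this
      tauto
    · have := key S hWS hyS z hz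
      tauto

theorem Ctx.inf_half (c : Ctx G T E) (hY : IsCylinder T G Y) {S : Set V}
    (hS : IsSpecialForest T S Y) (hi : S.Infinite) :
    ∃ x y, T.Adj x y ∧ halfTree T x y ⊆ S := by
  obtain ⟨W, hWf, hWY, hWS, hW1, hW2⟩ := c.hang hY hS
  obtain ⟨w, hw, hwW⟩ := (hi.diff hWf).nonempty
  obtain ⟨x, hx, y, hy, hxy, hwh⟩ := hW1 w hwW
  have h2 := (hW2 x hx y hy hxy).2
  exact ⟨x, y, hxy, fun z hz => (h2 z hz).2 ((h2 w hwh).1 hw)⟩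

theorem Ctx.inf_far (c : Ctx G T E) (hY : IsCylinder T G Y) {S : Set V}
    (hS : IsSpecialForest T S Y) (hi : S.Infinite) (a u : V) (R : ℕ) :
    ∃ g : G, g • u ∈ S ∧ R < T.dist a (g • u) := by
  obtain ⟨x, y, hxy, hs⟩ := c.inf_half hY hS hi
  obtain ⟨x', y', h1, h2, h3, h4⟩ := c.far hxy a R
  obtain ⟨g, hg⟩ := c.orbit h1 u
  exact ⟨g, hs (h2 hg), h4 _ hg⟩

/-! ### Algebra of special forests -/

theorem cobdry_compl (S : Set V) : cobdry T Sᶜ = cobdry T S := by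
  ext e
  induction e using Sym2.ind with
  | _ x y =>
    by_cases h : T.Adj x y
    · rw [cob_iff h, cob_iff h]
      simp only [Set.mem_compl_iff]
      tauto
    · exact ⟨fun hc => absurd (cobdry_edge hc) h, fun hc => absurd (cobdry_edge hc) h⟩

theorem cobdry_inter (S S' : Set V) : cobdry T (S ∩ S') ⊆ cobdry T S ∪ cobdry T S' := by
  intro e
  induction e using Sym2.ind with
  | _ x y =>
    intro he
    have h := cobdry_edge he
    rw [cob_iff h] at he
    rw [Set.mem_union, cob_iff h, cob_iff h]
    simp only [Set.mem_inter_iff] at he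
    tauto

theorem Sp.compl {S : Set V} (h : IsSpecialForest T S Y) : IsSpecialForest T Sᶜ Y := by
  unfold IsSpecialForest at *
  rwa [cobdry_compl]

theorem Sp.inter {S S' : Set V} (h : IsSpecialForest T S Y) (h' : IsSpecialForest T S' Y) :
    IsSpecialForest T (S ∩ S') Y :=
  ⟨(h.1.union h'.1).subset (cobdry_inter S S'),
    (cobdry_inter S S').trans (Set.union_subset h.2 h'.2)⟩

theorem Sp.union {S S' : Set V} (h : IsSpecialForest T S Y) (h' : IsSpecialForest T S' Y) :
    IsSpecialForest T (S ∪ S') Y := by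
  have := Sp.compl (Sp.inter (Sp.compl h) (Sp.compl h'))
  rwa [← Set.compl_union, compl_compl] at this

theorem Sp.symmDiff {S S' : Set V} (h : IsSpecialForest T S Y) (h' : IsSpecialForest T S' Y) :
    IsSpecialForest T (S ∆ S') Y := by
  have e : S ∆ S' = (S ∩ S'ᶜ) ∪ (S' ∩ Sᶜ) := by
    ext x
    simp [Set.mem_symmDiff]
  rw [e]
  exact Sp.union (Sp.inter h (Sp.compl h')) (Sp.inter h' (Sp.compl h))

theorem Ctx.sp_half (c : Ctx G T E) {x y : V} (h : T.Adj x y) (hY : s(x, y) ∈ Y) :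
    IsSpecialForest T (halfTree T x y) Y := by
  unfold IsSpecialForest
  rw [ht_cob c.hT h]
  exact ⟨Set.finite_singleton _, by simpa using hY⟩

end CtxLemmas

end SSRN
namespace SSRN

section Forests
variable {G V : Type*} [Group G] [MulAction G V] {T : SimpleGraph V} {E : Set (Subgroup G)}
  {Y : Set (Sym2 V)}

theorem hf_edge (hY : IsCylinder T G Y) {e e2 : Sym2 V} (he : e ∈ Y) (he2 : e2 ∈ Y)
    (e1 : Sym2 V) : HFin (edgeStab G e) {g : G | Sym2.map (g • ·) e1 = e2} := by
  by_cases hn : ∃ g0 : G, Sym2.map (g0 • ·) e1 = e2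
  · obtain ⟨g0, hg0⟩ := hn
    refine ((HFin.coset (edgeStab G e2) g0).comm (hY.comm he he2)).mono fun g hg => ?_
    have hg : Sym2.map (g • ·) e1 = e2 := hg
    show g * g0⁻¹ ∈ edgeStab G e2
    rw [mem_edgeStab]
    conv_lhs => rw [← hg0]
    rw [Sym2.map_map]
    have : ((fun x : V => (g * g0⁻¹) • x) ∘ fun x => g0 • x) = (g • ·) := by
      funext x; simp [mul_smul]
    rw [this, hg]
  · refine (HFin.empty _).mono fun g hg => ?_
    exact absurd ⟨g, hg⟩ hn

theorem Ctx.XS_dif (c : Ctx G T E) (hY : IsCylinder T G Y) {S : Set V}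
    (hS : IsSpecialForest T S Y) {e : Sym2 V} (he : e ∈ Y) (v₀ : V) (t : G) :
    HFin (edgeStab G e) (Dif (XS G v₀ S) t) := by
  obtain ⟨p⟩ := c.hT.1 v₀ (t • v₀)
  have h1 : HFin (edgeStab G e) (⋃ f ∈ {f | f ∈ p.edges}, ⋃ b ∈ cobdry T S,
      {g : G | Sym2.map (g • ·) f = b}) :=
    HFin.biUnion (List.finite_toSet p.edges) fun f _ =>
      HFin.biUnion hS.1 fun b hb => hf_edge hY he (hS.2 hb) f
  refine h1.mono fun g hg => ?_
  have hg' : ¬ (v₀ ∈ {w | g • w ∈ S} ↔ t • v₀ ∈ {w | g • w ∈ S}) := by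
    intro hc
    apply hg
    show g • v₀ ∈ S ↔ (g * t) • v₀ ∈ S
    rw [mul_smul]
    exact hc
  obtain ⟨f, hf, hf'⟩ := exists_cob p hg'
  simp only [Set.mem_iUnion]
  exact ⟨f, hf, _, cob_smul c hf', rfl⟩

theorem exists_stab_edges (hY : IsCylinder T G Y) {e : Sym2 V} (he : e ∈ Y) {F : Set (Sym2 V)}
    (hF : F.Finite) (hFY : F ⊆ Y) : ∃ K : Subgroup G, K ≤ edgeStab G e ∧
      Subgroup.Commensurable K (edgeStab G e) ∧ ∀ b ∈ F, K ≤ edgeStab G b := by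
  induction F, hF using Set.Finite.induction_on with
  | empty => exact ⟨_, le_rfl, Subgroup.Commensurable.refl _, by simp⟩
  | @insert a s ha hs ih =>
    obtain ⟨K, h1, h2, h3⟩ := ih fun x hx => hFY (Set.mem_insert_of_mem _ hx)
    refine ⟨K ⊓ edgeStab G a, inf_le_left.trans h1,
      comm_inf h2 (hY.comm (hFY (Set.mem_insert _ _)) he), ?_⟩
    rintro b (rfl | hb)
    · exact inf_le_right
    · exact inf_le_left.trans (h3 b hb)

theorem Ctx.exists_stab (c : Ctx G T E) (hY : IsCylinder T G Y) {S : Set V}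
    (hS : IsSpecialForest T S Y) {e : Sym2 V} (he : e ∈ Y) : ∃ K : Subgroup G,
      K ≤ edgeStab G e ∧ Subgroup.Commensurable K (edgeStab G e) ∧
      ∀ k ∈ K, ∀ w : V, k • w ∈ S ↔ w ∈ S := by
  obtain ⟨K, h1, h2, h3⟩ := exists_stab_edges hY he hS.1 hS.2
  refine ⟨K, h1, h2, fun k hk => ?_⟩
  obtain ⟨a, hae⟩ : ∃ a, a ∈ e := by
    induction e using Sym2.ind with
    | _ x y => exact ⟨x, by simp⟩
  have key : {w | k • w ∈ S} = S := by
    refine eq_of_cob c.hT.1 (a := a) (fun x y hxy => ?_) ?_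
    · have e1 : s(x, y) ∈ cobdry T {w | k • w ∈ S} ↔ s(x, y) ∈ cobdry T S := by
        constructor
        · intro h
          have h4 := cob_smul c h
          have h5 := (edgeStab G _).inv_mem (h3 _ h4 hk)
          have h6 : Sym2.map (k • ·) s(x, y) = s(x, y) := by
            have h7 := h3 _ h4 hk
            rw [mem_edgeStab] at h7
            exact map_smul_inj k h7
          rwa [h6] at h4
        · intro h
          have h5 := h3 _ h hk
          have h6 := c.fix hxy h5
          rw [cob_iff hxy] at h ⊢
          simp only [Set.mem_setOf_eq, h6.1, h6.2]
          exact h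
      rw [cob_iff hxy, cob_iff hxy] at e1
      tauto
    · have := c.fix_mem (hY.2.1 he) (h1 hk) hae
      simp only [Set.mem_setOf_eq, this]
  intro w
  exact Set.ext_iff.1 key w

theorem Ctx.bounded (c : Ctx G T E) (hY : IsCylinder T G Y) {e : Sym2 V} (he : e ∈ Y) {a : V}
    (ha : a ∈ e) {X : Set G} (hX : HFin (edgeStab G e) X) (v₀ : V) :
    ∃ R : ℕ, ∀ g ∈ X, T.dist a (g • v₀) ≤ R := by
  obtain ⟨F, hF⟩ := hfin_iff.1 hX
  refine ⟨F.sup fun f => T.dist a (f • v₀), fun g hg => ?_⟩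
  obtain ⟨f, hf, k, hk, rfl⟩ := hF g hg
  have h1 := c.fix_mem (hY.2.1 he) hk ha
  have h2 : T.dist a ((k * f) • v₀) = T.dist a (f • v₀) := by
    conv_lhs => rw [← h1, mul_smul]
    exact c.dist_smul k _ _
  rw [h2]
  exact Finset.le_sup (f := fun f => T.dist a (f • v₀)) hf

theorem Ctx.not_hfin (c : Ctx G T E) (hY : IsCylinder T G Y) {S : Set V}
    (hS : IsSpecialForest T S Y) {e : Sym2 V} (he : e ∈ Y) (v₀ : V) (hi : S.Infinite) :
    ¬ HFin (edgeStab G e) (XS G v₀ S) := by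
  intro h
  obtain ⟨a, hae⟩ : ∃ a, a ∈ e := by
    induction e using Sym2.ind with
    | _ x y => exact ⟨x, by simp⟩
  obtain ⟨R, hR⟩ := c.bounded hY he hae h v₀
  obtain ⟨g, hg, hg'⟩ := c.inf_far hY hS hi a v₀ R
  have := hR g hg
  omega

theorem sym2_exists (e : Sym2 V) : ∃ a, a ∈ e := by
  induction e using Sym2.ind with
  | _ x y => exact ⟨x, by simp⟩

/-- a bounded set of group elements which is part of a non-trivial a.i. set cannot be everything -/
theorem Ctx.not_bounded (c : Ctx G T E) (hY : IsCylinder T G Y) {H : Subgroup G} {X : Set G}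
    (hX : NontrivAI H X) (a v₀ : V) (R : ℕ) : ¬ ∀ g ∈ X, T.dist a (g • v₀) ≤ R := by
  intro hR
  obtain ⟨e, he⟩ := hY.1
  have hu : IsSpecialForest T (Set.univ : Set V) Y := by
    have : cobdry T (Set.univ : Set V) = ∅ := by
      ext f
      simp [cobdry]
    unfold IsSpecialForest
    rw [this]
    simp
  have hinf : (Set.univ : Set V).Infinite := by
    obtain ⟨a, b, d, _, _, _, h, _⟩ := c.hval3 v₀
    exact (c.ht_infinite h).mono (Set.subset_univ _)
  obtain ⟨t, _, ht⟩ := c.inf_far hY hu hinf v₀ v₀ (2 * R)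
  refine hX.2.1 ((hX.1.dif t).mono fun g hg hc => ?_)
  have h1 := hR g hg
  have h2 := hR _ (hc.1 hg)
  have h3 := c.dist_smul g v₀ (t • v₀)
  have h4 := c.hT.1.dist_triangle (u := g • v₀) (v := a) (w := g • t • v₀)
  rw [mul_smul] at h2
  rw [SimpleGraph.dist_comm] at h1
  omega

theorem Ctx.comm_of_rep (c : Ctx G T E) (hY : IsCylinder T G Y) {S : Set V}
    (hS : IsSpecialForest T S Y) {e : Sym2 V} (he : e ∈ Y) {v₀ : V} {H : Subgroup G} {X : Set G}
    (hX : NontrivAI H X) (hr : HFin (edgeStab G e) (X ∆ XS G v₀ S)) :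
    Subgroup.Commensurable H (edgeStab G e) ∧ S.Infinite ∧ Sᶜ.Infinite := by
  obtain ⟨a, hae⟩ := sym2_exists e
  obtain ⟨R, hR⟩ := c.bounded hY he hae hr v₀
  have key : ∀ (X : Set G) (S : Set V), NontrivAI H X →
      (∀ g ∈ X ∆ XS G v₀ S, T.dist a (g • v₀) ≤ R) → S.Infinite := by
    intro X S hX hR hf
    obtain ⟨M, hM⟩ := (hf.image (T.dist a)).bddAbove
    refine c.not_bounded hY hX a v₀ (max R M) fun g hg => ?_
    by_cases hgS : g • v₀ ∈ S
    · exact (hM ⟨_, hgS, rfl⟩).trans (le_max_right _ _)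
    · exact (hR g (Or.inl ⟨hg, hgS⟩)).trans (le_max_left _ _)
  have h1 : S.Infinite := key X S hX hR
  have h2 : Sᶜ.Infinite := by
    refine key Xᶜ Sᶜ hX.compl ?_
    have : XS G v₀ Sᶜ = (XS G v₀ S)ᶜ := rfl
    rw [this, symmDiff_compl_compl']
    exact hR
  refine ⟨⟨?_, ?_⟩, h1, h2⟩
  · obtain ⟨K, hK1, hK2, hK3⟩ := c.exists_stab hY hS he
    obtain ⟨s, hs, hs'⟩ := c.inf_far hY hS h1 a v₀ R
    obtain ⟨t, ht, ht'⟩ := c.inf_far hY (Sp.compl hS) h2 a v₀ R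
    have h3 : H.relIndex K ≠ 0 := by
      refine relIndex_of_hfin (f := s) (hX.1.dif (s⁻¹ * t)) fun k hk hc => ?_
      have hka : k • a = a := c.fix_mem (hY.2.1 he) (hK1 hk) hae
      have far : ∀ r : G, R < T.dist a (r • v₀) → (k * r ∈ X ↔ r • v₀ ∈ S) := by
        intro r hr
        have h5 : k * r ∉ X ∆ XS G v₀ S := by
          intro hm
          have h6 := hR _ hm
          rw [mul_smul] at h6
          have h7 := c.dist_smul k a (r • v₀)
          rw [hka] at h7
          omega
        have h6 : k * r ∈ XS G v₀ S ↔ r • v₀ ∈ S := by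
          show (k * r) • v₀ ∈ S ↔ _
          rw [mul_smul]
          exact hK3 k hk _
        rw [Set.mem_symmDiff] at h5
        tauto
      have h5 : k * s * (s⁻¹ * t) = k * t := by group
      rw [h5] at hc
      exact ht ((far t ht').1 (hc.1 ((far s hs').2 hs)))
    exact Subgroup.relIndex_ne_zero_trans h3 hK2.1
  · obtain ⟨t, g, hg⟩ := hX.exists_dif
    have h3 : HFin (edgeStab G e) (Dif X t) := by
      refine ((c.XS_dif hY hS he v₀ t).union (hr.union (hr.rmul t))).mono fun x hx => ?_
      simp only [Dif, Set.mem_union, Set.mem_setOf_eq, Set.mem_symmDiff] at *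
      tauto
    refine relIndex_of_hfin (f := g) h3 fun h hh hc => ?_
    rw [mul_assoc, hX.1.inv hh, hX.1.inv hh] at hc
    exact hg hc

theorem Ctx.XS_nontriv (c : Ctx G T E) (hY : IsCylinder T G Y) {S : Set V}
    (hS : IsSpecialForest T S Y) {e : Sym2 V} (he : e ∈ Y) (v₀ : V) (h1 : S.Infinite)
    (h2 : Sᶜ.Infinite) :
    ∃ K : Subgroup G, Subgroup.Commensurable K (edgeStab G e) ∧ NontrivAI K (XS G v₀ S) := by
  obtain ⟨K, hK1, hK2, hK3⟩ := c.exists_stab hY hS he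
  refine ⟨K, hK2, isAI_of_dif ?_ ?_, ?_, ?_⟩
  · intro k hk x
    show (k * x) • v₀ ∈ S ↔ x • v₀ ∈ S
    rw [mul_smul]
    exact hK3 k hk _
  · exact fun t => (c.XS_dif hY hS he v₀ t).comm hK2
  · exact fun h => c.not_hfin hY hS he v₀ h1 (h.comm hK2.symm)
  · exact fun h => c.not_hfin hY (Sp.compl hS) he v₀ h2 (h.comm hK2.symm)

/-! ### boundary -/

theorem ht_path_support (u v : V) {w : V} (p : T.Walk v w) (hp : p.IsPath)
    (he : s(u, v) ∉ p.edges) {z : V} (hz : z ∈ p.support) : z ∈ halfTree T u v := by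
  classical
  exact ⟨p.takeUntil z hz, hp.takeUntil hz, fun hc => he (p.edges_takeUntil_subset_edges hz hc)⟩

theorem Ctx.ht_nonY (c : Ctx G T E) (hY : IsCylinder T G Y) {v u : V} (hv : v ∈ cylVerts Y)
    (hvu : T.Adj v u) (hn : s(v, u) ∉ Y) {S : Set V} (hS : IsSpecialForest T S Y) {z : V}
    (hz : z ∈ halfTree T v u) : v ∈ S ↔ z ∈ S := by
  classical
  obtain ⟨q, hq, hqe⟩ := hz
  have hvq : v ∉ q.support := fun hc => ht_left c.hT hvu (ht_path_support v u q hq hqe hc)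
  have h1 : v ∈ S ↔ u ∈ S := by
    by_contra hne
    rw [← cob_iff hvu] at hne
    exact hn (hS.2 hne)
  rw [h1]
  apply walk_iff q
  intro f hf hfc
  have hfY := hS.2 hfc
  induction f using Sym2.ind with
  | _ x y =>
    have hx : x ∈ q.support := q.fst_mem_support_of_mem_edges hf
    have hxY : x ∈ cylVerts Y := ⟨_, hfY, by simp⟩
    have hpath : (SimpleGraph.Walk.cons hvu (q.takeUntil x hx)).IsPath := by
      rw [SimpleGraph.Walk.cons_isPath_iff]
      exact ⟨hq.takeUntil hx, fun hc => hvq (q.support_takeUntil_subset_support hx hc)⟩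
    exact hn (c.cyl_path hY hv hxY _ hpath (by simp))

theorem Ctx.bd_infinite (c : Ctx G T E) (hY : IsCylinder T G Y) {S : Set V}
    (hS : IsSpecialForest T S Y) {v : V} (hv : v ∈ cylBoundary T Y) (hvS : v ∈ S) :
    S.Infinite := by
  obtain ⟨hvY, f, hf, hvf, hfY⟩ := hv
  obtain ⟨u, rfl⟩ : ∃ u, f = s(v, u) := Sym2.mem_iff_exists.1 hvf
  exact (c.ht_infinite hf).mono fun z hz => (c.ht_nonY hY hvY hf hfY hS hz).1 hvS

theorem bd_of_walk {S : Set V} (hS : IsSpecialForest T S Y) {w a : V} (p : T.Walk w a)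
    (hwS : w ∈ S) (hw : w ∉ cylVerts Y) (ha : a ∈ cylVerts Y) : ∃ v ∈ cylBoundary T Y, v ∈ S := by
  induction p with
  | nil => exact absurd ha hw
  | @cons u v d h p ih =>
    have hne : s(u, v) ∉ Y := fun hc => hw ⟨_, hc, by simp⟩
    have hvS : v ∈ S := by
      have : u ∈ S ↔ v ∈ S := by
        by_contra hc
        rw [← cob_iff h] at hc
        exact hne (hS.2 hc)
      exact this.1 hwS
    by_cases hv : v ∈ cylVerts Y
    · exact ⟨v, ⟨hv, _, h, by simp, hne⟩, hvS⟩
    · exact ih hvS hv ha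

theorem IsCylinder.exists_vert (hY : IsCylinder T G Y) : ∃ a, a ∈ cylVerts Y := by
  obtain ⟨e, he⟩ := hY.1
  obtain ⟨a, ha⟩ := sym2_exists e
  exact ⟨a, e, he, ha⟩

theorem Ctx.exists_bd (c : Ctx G T E) (hY : IsCylinder T G Y) {S : Set V}
    (hS : IsSpecialForest T S Y) (hi : S.Infinite) (hb : (cylBoundary T Y).Nonempty) :
    ∃ v ∈ cylBoundary T Y, v ∈ S := by
  obtain ⟨u, ⟨e1, he1, hue1⟩, e2, he2, hue2, he2Y⟩ := hb
  obtain ⟨x, y, hxy, hs⟩ := c.inf_half hY hS hi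
  obtain ⟨g, hg⟩ := c.orbit hxy u
  by_cases hgY : g • u ∈ cylVerts Y
  · by_contra hc
    push Not at hc
    have hall : ∀ w, T.Adj (g • u) w → s(g • u, w) ∈ Y := by
      intro w hw
      by_contra hn
      exact hc (g • u) ⟨hgY, _, hw, by simp, hn⟩ (hs hg)
    obtain ⟨w1, rfl⟩ : ∃ w, e1 = s(u, w) := Sym2.mem_iff_exists.1 hue1
    obtain ⟨w2, rfl⟩ : ∃ w, e2 = s(u, w) := Sym2.mem_iff_exists.1 hue2
    have a1 : T.Adj u w1 := hY.2.1 he1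
    have a2 : T.Adj u w2 := he2
    have h1 := hall _ (c.hact g _ _ a1)
    have h2 := hall _ (c.hact g _ _ a2)
    have h3 := hY.comm h1 h2
    apply he2Y
    refine (hY.2.2 _ he1 _ he2).2 ?_
    have e : ∀ w, edgeStab G s(g • u, g • w) =
        (ConjAct.toConjAct g) • edgeStab G s(u, w) := by
      intro w
      ext k
      rw [Subgroup.mem_pointwise_smul_iff_inv_smul_mem, mem_edgeStab, mem_edgeStab]
      have : (ConjAct.toConjAct g)⁻¹ • k = g⁻¹ * k * g := by
        rw [← ConjAct.toConjAct_inv, ConjAct.toConjAct_smul]; simp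
      rw [this]
      simp only [Sym2.map_mk]
      constructor
      · intro hk
        have := congrArg (Sym2.map (g⁻¹ • ·)) hk
        simpa [Sym2.map_mk, mul_smul] using this
      · intro hk
        have := congrArg (Sym2.map (g • ·)) hk
        simpa [Sym2.map_mk, mul_smul] using this
    rw [e, e] at h3
    exact (Subgroup.Commensurable.commensurable_conj _).2 h3
  · obtain ⟨a, ha⟩ := hY.exists_vert
    obtain ⟨p⟩ := c.hT.1 (g • u) a
    exact bd_of_walk hS p (hs hg) hgY ha

theorem Ctx.fin_hfin (c : Ctx G T E) (hY : IsCylinder T G Y) {S : Set V}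
    (hS : IsSpecialForest T S Y) {e : Sym2 V} (he : e ∈ Y) (v₀ : V) (hf : S.Finite) :
    HFin (edgeStab G e) (XS G v₀ S) := by
  have hSb : ∀ v ∈ S, v ∉ cylBoundary T Y := fun v hv hb => c.bd_infinite hY hS hb hv hf
  have hSY : S ⊆ cylVerts Y := by
    intro w hw
    by_contra hn
    obtain ⟨a, ha⟩ := hY.exists_vert
    obtain ⟨p⟩ := c.hT.1 w a
    obtain ⟨v, hv, hvS⟩ := bd_of_walk hS p hw hn ha
    exact hSb v hvS hv
  obtain ⟨u₀, _, _, _, _, _, hu₀, _⟩ := c.hval3 v₀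
  have hnb : ∀ w ∈ S, ∀ u, T.Adj w u → u ∈ S ∪ ⋃ b ∈ cobdry T S, {x | x ∈ b} := by
    intro w hw u hwu
    by_cases hu : u ∈ S
    · exact Or.inl hu
    · right
      simp only [Set.mem_iUnion]
      exact ⟨s(w, u), (cob_iff hwu).2 (by tauto), by simp⟩
  have hPf : (S ∪ ⋃ b ∈ cobdry T S, {x | x ∈ b}).Finite :=
    hf.union (hS.1.biUnion fun b _ => sym2_finite b)
  have h1 : HFin (edgeStab G e) (⋃ w ∈ S, ⋃ u ∈ {u | u ∈ (S ∪ ⋃ b ∈ cobdry T S, {x | x ∈ b}) ∧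
      s(w, u) ∈ Y}, {g : G | Sym2.map (g • ·) s(v₀, u₀) = s(w, u)}) :=
    HFin.biUnion hf fun w _ => HFin.biUnion (hPf.subset fun u hu => hu.1) fun u hu =>
      hf_edge hY he hu.2 _
  refine h1.mono fun g hg => ?_
  have hg : g • v₀ ∈ S := hg
  have hadj := c.hact g _ _ hu₀
  simp only [Set.mem_iUnion]
  refine ⟨g • v₀, hg, g • u₀, ⟨hnb _ hg _ hadj, ?_⟩, by simp [Sym2.map_mk]⟩
  by_contra hn
  exact hSb _ hg ⟨hSY hg, _, hadj, by simp, hn⟩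

/-! ### peripheral forests -/

theorem Ctx.peri_sub (c : Ctx G T E) (hY : IsCylinder T G Y) {v : V} (hv : v ∈ cylVerts Y)
    {S : Set V} (hS : IsSpecialForest T S Y) {z : V} (hz : z ∈ periForest T Y v) :
    v ∈ S ↔ z ∈ S := by
  classical
  obtain ⟨p, hp, hpe⟩ := hz
  apply walk_iff p
  intro f hf hfc
  have hfY := hS.2 hfc
  induction f using Sym2.ind with
  | _ x y =>
    have hx : x ∈ p.support := p.fst_mem_support_of_mem_edges hf
    have hxY : x ∈ cylVerts Y := ⟨_, hfY, by simp⟩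
    have hxv : v ≠ x := by
      rintro rfl
      exact hpe _ hfY (by simp) hf
    have h1 := fun f hf => c.cyl_path hY hv hxY _ (hp.takeUntil hx) (f := f) hf
    have h2 := p.edges_takeUntil_subset_edges hx
    generalize p.takeUntil x hx = q at h1 h2
    cases q with
    | nil => exact hxv rfl
    | @cons _ u _ h q => exact hpe s(v, u) (h1 _ (by simp)) (by simp) (h2 (by simp))

theorem peri_self (v : V) : v ∈ periForest T Y v := ⟨.nil, by simp, by simp⟩

theorem peri_step {v x y : V} (hxy : T.Adj x y) (hx : x ∈ periForest T Y v)
    (hne : ¬ (s(x, y) ∈ Y ∧ v ∈ s(x, y))) : y ∈ periForest T Y v := by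
  classical
  obtain ⟨p, hp, he⟩ := hx
  refine ⟨(p.concat hxy).bypass, SimpleGraph.Walk.bypass_isPath _, fun e heY hve hc => ?_⟩
  have := SimpleGraph.Walk.edges_bypass_subset_edges _ hc
  rw [SimpleGraph.Walk.edges_concat] at this
  simp only [List.concat_eq_append, List.mem_append, List.mem_singleton] at this
  rcases this with h | rfl
  · exact he e heY hve h
  · exact hne ⟨heY, hve⟩

theorem peri_cob (v : V) : cobdry T (periForest T Y v) ⊆ {e | e ∈ Y ∧ v ∈ e} := by
  intro e he
  induction e using Sym2.ind with
  | _ x y =>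
    have hxy : T.Adj x y := cobdry_edge he
    rw [cob_iff hxy] at he
    by_contra hn
    apply he
    refine ⟨fun h => peri_step hxy h hn, fun h => peri_step hxy.symm h ?_⟩
    rwa [Sym2.eq_swap]

theorem peri_sp {v : V} (hf : FiniteValenceIn Y v) :
    IsSpecialForest T (periForest T Y v) Y :=
  ⟨hf.subset (peri_cob v), fun _ he => (peri_cob v he).1⟩

theorem Ctx.peri_not (c : Ctx G T E) (hY : IsCylinder T G Y) {v v' : V} (hv : v ∈ cylVerts Y)
    (hv' : v' ∈ cylVerts Y) (hne : v ≠ v') : v' ∉ periForest T Y v := by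
  rintro ⟨p, hp, he⟩
  have h1 := fun f hf => c.cyl_path hY hv hv' p hp (f := f) hf
  cases p with
  | nil => exact hne rfl
  | @cons _ u _ h q => exact he s(v, u) (h1 _ (by simp)) (by simp) (by simp)

theorem Ctx.sep (c : Ctx G T E) (hY : IsCylinder T G Y) {v v' : V} (hv : v ∈ cylVerts Y)
    (hv' : v' ∈ cylVerts Y) (hne : v ≠ v') : ∃ x y, T.Adj x y ∧ s(x, y) ∈ Y ∧
      v ∈ halfTree T x y ∧ v' ∉ halfTree T x y := by
  obtain ⟨p, hp⟩ := exists_path c.hT v' v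
  have h1 := fun f hf => c.cyl_path hY hv' hv p hp (f := f) hf
  cases p with
  | nil => exact absurd rfl hne
  | @cons _ u _ h q =>
    rw [SimpleGraph.Walk.cons_isPath_iff] at hp
    exact ⟨v', u, h, h1 _ (by simp),
      ⟨q, hp.1, fun hc => hp.2 (q.fst_mem_support_of_mem_edges hc)⟩, ht_left c.hT h⟩

theorem Ctx.ht_sub_peri (c : Ctx G T E) {x y : V} (h : T.Adj x y) (hn : s(x, y) ∉ Y) :
    halfTree T x y ⊆ periForest T Y x := by
  rintro w ⟨q, hq, hqe⟩
  have hxq : x ∉ q.support := fun hc => ht_left c.hT h (ht_path_support x y q hq hqe hc)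
  refine ⟨.cons h q, by rw [SimpleGraph.Walk.cons_isPath_iff]; exact ⟨hq, hxq⟩, ?_⟩
  intro e he hxe hc
  rw [SimpleGraph.Walk.edges_cons, List.mem_cons] at hc
  rcases hc with rfl | hc
  · exact hn he
  · exact hxq (q.mem_support_of_mem_edges hc hxe)

theorem Ctx.atom (c : Ctx G T E) (hY : IsCylinder T G Y) {S : Set V}
    (hS : IsSpecialForest T S Y) (hi : S.Infinite)
    (hns : ∀ x y, T.Adj x y → s(x, y) ∈ Y →
      (S ∩ halfTree T x y).Finite ∨ (S \ halfTree T x y).Finite) :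
    ∃ v ∈ cylBoundary T Y, FiniteValenceIn Y v ∧ (S ∆ periForest T Y v).Finite := by
  obtain ⟨W, hWf, hWY, hWS, hW1, hW2⟩ := c.hang hY hS
  by_cases hcase : ∃ x ∈ W, ∃ y, y ∉ W ∧ T.Adj x y ∧ s(x, y) ∈ Y ∧ y ∈ S
  · obtain ⟨x, hx, y, hy, hxy, hxyY, hyS⟩ := hcase
    have hsub : halfTree T x y ⊆ S := fun z hz => ((hW2 x hx y hy hxy).2 z hz).2 hyS
    have hfin : (S \ halfTree T x y).Finite := by
      refine (hns x y hxy hxyY).resolve_left fun hc => ?_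
      rw [Set.inter_eq_right.2 hsub] at hc
      exact c.ht_infinite hxy hc
    have hnY : ∀ z, T.Adj y z → z ≠ x → s(y, z) ∉ Y := by
      intro z hz hzx hzY
      have hfin2 : (S \ halfTree T y z).Finite := by
        refine (hns y z hz hzY).resolve_left fun hc => ?_
        rw [Set.inter_eq_right.2 ((ht_sub c.hT hxy hz hzx).trans hsub)] at hc
        exact c.ht_infinite hz hc
      obtain ⟨z', hz'z, hz'x, hz'⟩ : ∃ z', z' ≠ z ∧ z' ≠ x ∧ T.Adj y z' := by
        obtain ⟨a, b, hab, ha, hb, h1, h2⟩ := c.nbrs x y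
        by_cases h : a = z
        · exact ⟨b, fun h' => hab (h.trans h'.symm), hb, h2⟩
        · exact ⟨a, h, ha, h1⟩
      refine c.ht_infinite hz' (hfin2.subset fun w hw => ⟨?_, ?_⟩)
      · exact hsub (ht_sub c.hT hxy hz' hz'x hw)
      · exact fun hc => ht_disj c.hT hz hz' hz'z.symm hc hw
    have hedge : ∀ e ∈ Y, y ∈ e → e = s(x, y) := by
      intro e he hye
      obtain ⟨u, rfl⟩ : ∃ u, e = s(y, u) := Sym2.mem_iff_exists.1 hye
      by_cases hux : u = x
      · rw [hux, Sym2.eq_swap]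
      · exact absurd he (hnY u (hY.2.1 he) hux)
    have hperi : periForest T Y y = halfTree T x y := by
      ext w
      constructor
      · rintro ⟨p, hp, he⟩
        exact ⟨p, hp, he _ hxyY (by simp)⟩
      · rintro ⟨p, hp, he⟩
        refine ⟨p, hp, fun e heY hye => ?_⟩
        rwa [hedge e heY hye]
    refine ⟨y, ⟨⟨_, hxyY, by simp⟩, ?_⟩, ?_, ?_⟩
    · obtain ⟨z, _, _, hzx, _, hz, _⟩ := c.nbrs x y
      exact ⟨s(y, z), hz, by simp, hnY z hz hzx⟩
    · exact (Set.finite_singleton s(x, y)).subset fun e he => hedge e he.1 he.2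
    · rw [hperi]
      refine hfin.subset ?_
      rintro w (hw | hw)
      · exact hw
      · exact absurd (hsub hw.1) hw.2
  · push Not at hcase
    obtain ⟨w, hw, hwW⟩ := (hi.sdiff hWf).nonempty
    obtain ⟨x, hx, y, hy, hxy, hwh⟩ := hW1 w hwW
    have h2 := (hW2 x hx y hy hxy).2
    have hyS : y ∈ S := (h2 w hwh).1 hw
    have hsub : halfTree T x y ⊆ S := fun z hz => (h2 z hz).2 hyS
    have hxyY : s(x, y) ∉ Y := fun hc => hcase x hx y hy hxy hc hyS
    have hxS : x ∈ S := (hWS y x hxy.symm hy).1 hyS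
    have hxY := hWY hx
    refine ⟨x, ⟨hxY, _, hxy, by simp, hxyY⟩, ?_, ?_⟩
    · refine (hWf.image fun u => s(x, u)).subset ?_
      rintro e ⟨he, hxe⟩
      obtain ⟨u, rfl⟩ : ∃ u, e = s(x, u) := Sym2.mem_iff_exists.1 hxe
      refine ⟨u, ?_, rfl⟩
      by_contra hu
      have hadj : T.Adj x u := hY.2.1 he
      exact hcase x hx u hu hadj he ((hWS u x hadj.symm hu).2 hxS)
    · refine hWf.subset ?_
      rintro z (⟨hzS, hzp⟩ | ⟨hzp, hzS⟩)
      · by_contra hzW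
        obtain ⟨x', hx', y', hy', hxy', hzh⟩ := hW1 z hzW
        have h2' := (hW2 x' hx' y' hy' hxy').2
        have hyS' : y' ∈ S := (h2' z hzh).1 hzS
        have hsub' : halfTree T x' y' ⊆ S := fun z hz => (h2' z hz).2 hyS'
        have hxyY' : s(x', y') ∉ Y := fun hc => hcase x' hx' y' hy' hxy' hc hyS'
        by_cases hxx : x = x'
        · subst hxx
          exact hzp (c.ht_sub_peri hxy' hxyY' hzh)
        · obtain ⟨p, q, hpq, hpqY, h3, h4⟩ := c.sep hY hxY (hWY hx') hxx
          have hsp := c.sp_half hpq hpqY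
          rcases hns p q hpq hpqY with hf | hf
          · refine c.ht_infinite hxy (hf.subset fun a ha => ⟨hsub ha, ?_⟩)
            exact (c.ht_nonY hY hxY hxy hxyY hsp ha).1 h3
          · refine c.ht_infinite hxy' (hf.subset fun a ha => ⟨hsub' ha, ?_⟩)
            exact fun hc => h4 ((c.ht_nonY hY (hWY hx') hxy' hxyY' hsp ha).2 hc)
      · exact absurd ((c.peri_sub hY hxY hS hzp).1 hxS) hzS

end Forests

end SSRN
namespace SSRN

section Final

variable {G V : Type*} [Group G] [MulAction G V] {T : SimpleGraph V} {E : Set (Subgroup G)}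
  {Y : Set (Sym2 V)} {v₀ : V}

/-! ### The Boolean algebra of special forests -/

theorem BCT.ze {H : Subgroup G} {x y : V} (h : T.Adj x y) (hxy : s(x, y) ∈ Y) :
    XS G v₀ (halfTree T x y) ∈ BCT T v₀ Y H := fun _ hF => hF.1 x y h hxy

theorem BCT.compl {H : Subgroup G} {X : Set G} (h : X ∈ BCT T v₀ Y H) : Xᶜ ∈ BCT T v₀ Y H :=
  fun F hF => hF.2.1 _ (h F hF)

theorem BCT.inter {H : Subgroup G} {X X' : Set G} (h : X ∈ BCT T v₀ Y H)
    (h' : X' ∈ BCT T v₀ Y H) : X ∩ X' ∈ BCT T v₀ Y H :=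
  fun F hF => hF.2.2.1 _ (h F hF) _ (h' F hF)

theorem BCT.symmDiff {H : Subgroup G} {X X' : Set G} (h : X ∈ BCT T v₀ Y H)
    (h' : X' ∈ BCT T v₀ Y H) : X ∆ X' ∈ BCT T v₀ Y H := by
  have : X ∆ X' = (X ∩ X')ᶜ ∩ (Xᶜ ∩ X'ᶜ)ᶜ := by
    ext g; simp only [Set.mem_symmDiff, Set.mem_inter_iff, Set.mem_compl_iff]; tauto
  rw [this]
  exact BCT.inter (BCT.compl (BCT.inter h h'))
    (BCT.compl (BCT.inter (BCT.compl h) (BCT.compl h')))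

theorem Ctx.XS_mem (c : Ctx G T E) (hY : IsCylinder T G Y) (v₀ : V) (H : Subgroup G)
    {S : Set V} (hS : IsSpecialForest T S Y) : XS G v₀ S ∈ BCT T v₀ Y H := by
  have key : ∀ F : Set (Sym2 V), F.Finite → ∀ S : Set V, cobdry T S = F → F ⊆ Y →
      XS G v₀ S ∈ BCT T v₀ Y H := by
    intro F hF
    induction F, hF using Set.Finite.induction_on with
    | empty =>
      intro S hS _
      obtain ⟨e, he⟩ := hY.1
      have hem : XS G v₀ (∅ : Set V) ∈ BCT T v₀ Y H := by
        induction e using Sym2.ind with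
        | _ x y =>
          have h1 : XS G v₀ (halfTree T x y) ∈ BCT T v₀ Y H := BCT.ze (hY.2.1 he) he
          have h2 := BCT.inter h1 (BCT.compl h1)
          rw [Set.inter_compl_self] at h2
          exact h2
      have hcob : ∀ x y, T.Adj x y → (x ∈ S ↔ y ∈ S) := by
        intro x y hxy
        by_contra hn
        rw [← cob_iff hxy, hS] at hn
        exact hn
      by_cases hv : v₀ ∈ S
      · have : Sᶜ = ∅ := eq_empty_of_cob c.hT.1 (S := Sᶜ) (a := v₀)
          (fun x y hxy => not_congr (hcob x y hxy)) (by simpa using hv)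
        have h3 : S = ∅ᶜ := by rw [← this, compl_compl]
        rw [h3]
        exact BCT.compl hem
      · rw [eq_empty_of_cob c.hT.1 hcob hv]
        exact hem
    | @insert a F ha hF ih =>
      intro S hS hFY
      have haY : a ∈ Y := hFY (by simp)
      have haS : a ∈ cobdry T S := by rw [hS]; simp
      induction a using Sym2.ind with
      | _ x y =>
        have hxy : T.Adj x y := cobdry_edge haS
        have h1 : cobdry T (S ∆ halfTree T x y) = F := by
          ext b
          induction b using Sym2.ind with
          | _ p q =>
            by_cases hpq : T.Adj p q
            · have e1 := cob_iff (S := S) hpq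
              have e2 := cob_iff (S := halfTree T x y) hpq
              rw [hS] at e1
              rw [ht_cob c.hT hxy] at e2
              rw [cob_iff hpq]
              simp only [Set.mem_symmDiff]
              simp only [Set.mem_insert_iff, Set.mem_singleton_iff] at e1 e2
              have e3 : s(p, q) = s(x, y) → s(p, q) ∉ F := fun h => h ▸ ha
              tauto
            · refine ⟨fun hc => absurd (cobdry_edge hc) hpq, fun hc => absurd ?_ hpq⟩
              exact hY.2.1 (hFY (Set.mem_insert_of_mem _ hc))
        have h2 := ih _ h1 ((Set.subset_insert _ _).trans hFY)
        have h3 := BCT.symmDiff h2 (BCT.ze (H := H) (v₀ := v₀) hxy haY)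
        have h4 : XS G v₀ (S ∆ halfTree T x y) ∆ XS G v₀ (halfTree T x y) = XS G v₀ S := by
          ext g
          simp only [XS, Set.mem_symmDiff, Set.mem_ofPred_eq]
          tauto
        rwa [h4] at h3
  exact key _ hS.1 S rfl hS.2

/-- `X` is represented by the special forest `S` based on the cylinder `Y ∋ e`. -/
structure Rep (T : SimpleGraph V) (v₀ : V) (Y : Set (Sym2 V)) (e : Sym2 V) (X : Set G)
    (S : Set V) : Prop where
  hY : IsCylinder T G Y
  he : e ∈ Y
  hS : IsSpecialForest T S Y
  hr : HFin (edgeStab G e) (X ∆ XS G v₀ S)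

theorem Rep.compl {e : Sym2 V} {X : Set G} {S : Set V} (r : Rep T v₀ Y e X S) :
    Rep T v₀ Y e Xᶜ Sᶜ := by
  refine ⟨r.hY, r.he, Sp.compl r.hS, ?_⟩
  have : XS G v₀ Sᶜ = (XS G v₀ S)ᶜ := rfl
  rw [this, symmDiff_compl_compl']
  exact r.hr

theorem Rep.self (hY : IsCylinder T G Y) {e : Sym2 V} (he : e ∈ Y) {S : Set V}
    (hS : IsSpecialForest T S Y) : Rep T v₀ Y e (XS G v₀ S) S :=
  ⟨hY, he, hS, by rw [symmDiff_self]; exact HFin.empty _⟩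

theorem sp_empty : IsSpecialForest T (∅ : Set V) Y := by
  have : cobdry T (∅ : Set V) = ∅ := by
    ext e; simp [cobdry]
  simp [IsSpecialForest, this]

theorem Ctx.BCT_rep (c : Ctx G T E) (hY : IsCylinder T G Y) {e : Sym2 V} (he : e ∈ Y)
    {X : Set G} (hX : X ∈ BCT T v₀ Y (edgeStab G e)) : ∃ S, Rep T v₀ Y e X S := by
  refine hX {X | ∃ S, Rep T v₀ Y e X S} ⟨?_, ?_, ?_, ?_⟩
  · intro u v h huv
    exact ⟨_, Rep.self hY he (c.sp_half h huv)⟩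
  · rintro X ⟨S, r⟩
    exact ⟨_, r.compl⟩
  · rintro X ⟨S, r⟩ X' ⟨S', r'⟩
    refine ⟨S ∩ S', hY, he, Sp.inter r.hS r'.hS, (r.hr.union r'.hr).mono ?_⟩
    intro g
    simp only [XS, Set.mem_symmDiff, Set.mem_inter_iff, Set.mem_union, Set.mem_ofPred_eq]
    tauto
  · rintro X ⟨S, r⟩ X' h
    refine ⟨S, hY, he, r.hS, hfin_symmDiff_trans ?_ r.hr⟩
    rwa [symmDiff_comm]

theorem Ctx.NB_rep (c : Ctx G T E) {X : Set G} (hX : X ∈ NontrivB T G v₀) :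
    ∃ Y e S, Rep T v₀ Y e X S := by
  obtain ⟨⟨Y, hY, e, he, h⟩, -⟩ := hX
  obtain ⟨S, r⟩ := c.BCT_rep hY he h
  exact ⟨Y, e, S, r⟩

theorem Rep.comm (c : Ctx G T E) {e : Sym2 V} {X : Set G} {S : Set V} (r : Rep T v₀ Y e X S)
    {H : Subgroup G} (hX : NontrivAI H X) : Subgroup.Commensurable H (edgeStab G e) :=
  (c.comm_of_rep r.hY r.hS r.he hX r.hr).1

theorem Ctx.XS_NB (c : Ctx G T E) (hY : IsCylinder T G Y) (v₀ : V) {S : Set V}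
    (hS : IsSpecialForest T S Y) (h1 : S.Infinite) (h2 : Sᶜ.Infinite) :
    XS G v₀ S ∈ NontrivB T G v₀ := by
  obtain ⟨e, he⟩ := hY.1
  refine ⟨⟨Y, hY, e, he, c.XS_mem hY v₀ _ hS⟩, ?_⟩
  obtain ⟨K, -, hK⟩ := c.XS_nontriv hY hS he v₀ h1 h2
  exact ⟨K, hK⟩

theorem ccRel_NB {X X' : Set G} (h : ccRel T G v₀ X X') :
    X ∈ NontrivB T G v₀ ↔ X' ∈ NontrivB T G v₀ := by
  induction h with
  | rel x y h => exact ⟨fun _ => h.2.1, fun _ => h.1⟩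
  | refl x => rfl
  | symm x y _ ih => exact ih.symm
  | trans x y z _ _ ih ih' => exact ih.trans ih'

theorem ccOf_eq {X X' : Set G} (h : ccRel T G v₀ X X') : ccOf T G v₀ X = ccOf T G v₀ X' := by
  ext Z
  exact ⟨fun hZ => .trans _ _ _ (.symm _ _ h) hZ, fun hZ => .trans _ _ _ h hZ⟩

theorem Ctx.XS_cross (c : Ctx G T E) (hY : IsCylinder T G Y) (v₀ : V) {S S' : Set V}
    (hS : IsSpecialForest T S Y) (hS' : IsSpecialForest T S' Y)
    (h1 : (S ∩ S').Infinite) (h2 : (S ∩ S'ᶜ).Infinite) (h3 : (Sᶜ ∩ S').Infinite)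
    (h4 : (Sᶜ ∩ S'ᶜ).Infinite) : ccRel T G v₀ (XS G v₀ S) (XS G v₀ S') := by
  obtain ⟨e, he⟩ := hY.1
  have i1 := h1.mono Set.inter_subset_left
  have i2 := h3.mono Set.inter_subset_left
  have i3 := h1.mono Set.inter_subset_right
  have i4 := h2.mono Set.inter_subset_right
  obtain ⟨H, hH, hn⟩ := c.XS_nontriv hY hS he v₀ i1 i2
  obtain ⟨K, hK, hn'⟩ := c.XS_nontriv hY hS' he v₀ i3 i4
  refine .rel _ _ ⟨c.XS_NB hY v₀ hS i1 i2, c.XS_NB hY v₀ hS' i3 i4, Or.inl ⟨H, K, hn, hn', ?_⟩⟩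
  exact ⟨fun h => c.not_hfin hY (Sp.inter hS hS') he v₀ h1 (h.comm hH.symm),
    fun h => c.not_hfin hY (Sp.inter hS (Sp.compl hS')) he v₀ h2 (h.comm hH.symm),
    fun h => c.not_hfin hY (Sp.inter (Sp.compl hS) hS') he v₀ h3 (h.comm hH.symm),
    fun h => c.not_hfin hY (Sp.inter (Sp.compl hS) (Sp.compl hS')) he v₀ h4 (h.comm hH.symm)⟩

theorem Rep.rel (c : Ctx G T E) {e : Sym2 V} {X : Set G} {S : Set V} (r : Rep T v₀ Y e X S)
    (hX : X ∈ NontrivB T G v₀) : ccRel T G v₀ X (XS G v₀ S) := by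
  obtain ⟨H, hH⟩ := hX.2
  obtain ⟨h1, h2, h3⟩ := c.comm_of_rep r.hY r.hS r.he hH r.hr
  exact .rel _ _ ⟨hX, c.XS_NB r.hY v₀ r.hS h2 h3, Or.inr ⟨H, hH, Or.inl (r.hr.comm h1)⟩⟩

theorem Ctx.XS_compl (c : Ctx G T E) (hY : IsCylinder T G Y) (v₀ : V) {S : Set V}
    (hS : IsSpecialForest T S Y) (h1 : S.Infinite) (h2 : Sᶜ.Infinite) :
    ccRel T G v₀ (XS G v₀ S) (XS G v₀ Sᶜ) := by
  obtain ⟨e, he⟩ := hY.1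
  obtain ⟨H, hH, hn⟩ := c.XS_nontriv hY hS he v₀ h1 h2
  refine .rel _ _ ⟨c.XS_NB hY v₀ hS h1 h2, c.XS_NB hY v₀ (Sp.compl hS) h2 (by rwa [compl_compl]),
    Or.inr ⟨H, hn, Or.inr ?_⟩⟩
  have : (XS G v₀ Sᶜ)ᶜ = XS G v₀ S := by
    ext g; simp [XS]
  rw [this, symmDiff_self]
  exact HFin.empty _

theorem Ctx.XS_equiv (c : Ctx G T E) (hY : IsCylinder T G Y) (v₀ : V) {S S' : Set V}
    (hS : IsSpecialForest T S Y) (h1 : S.Infinite) (h2 : Sᶜ.Infinite)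
    (hS' : IsSpecialForest T S' Y) (hf : (S ∆ S').Finite) :
    ccRel T G v₀ (XS G v₀ S) (XS G v₀ S') := by
  obtain ⟨e, he⟩ := hY.1
  refine Rep.rel c (e := e) (Y := Y) ⟨hY, he, hS', ?_⟩ (c.XS_NB hY v₀ hS h1 h2)
  exact c.fin_hfin hY (Sp.symmDiff hS hS') he v₀ hf

/-! ### Uniqueness -/

/-- `S` is split by an edge of `Y`. -/
def Split (T : SimpleGraph V) (Y : Set (Sym2 V)) (S : Set V) : Prop :=
  ∃ x y, T.Adj x y ∧ s(x, y) ∈ Y ∧ (S ∩ halfTree T x y).Infinite ∧ (S \ halfTree T x y).Infinite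

theorem Split.inf {S : Set V} (h : Split T Y S) : S.Infinite := by
  obtain ⟨x, y, -, -, h, -⟩ := h
  exact h.mono Set.inter_subset_left

theorem inf_of_diff {A B F : Set V} (hA : A.Infinite) (hF : F.Finite) (h : A \ F ⊆ B) :
    B.Infinite := (hA.sdiff hF).mono h

theorem Ctx.link1 (c : Ctx G T E) (hY : IsCylinder T G Y) (v₀ : V) {A B : Set V}
    (hA : IsSpecialForest T A Y) (hB : IsSpecialForest T B Y) (sA : Split T Y A)
    (sB : Split T Y B) (hf : (A ∩ B).Finite) : ccRel T G v₀ (XS G v₀ A) (XS G v₀ B) := by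
  obtain ⟨x, y, h, hxy, i1, i2⟩ := sA
  obtain ⟨x', y', h', hxy', i1', i2'⟩ := sB
  have hQ := Sp.union (Sp.inter hA (c.sp_half h hxy)) (Sp.inter hB (c.sp_half h' hxy'))
  refine .trans _ _ _ (c.XS_cross hY v₀ hA hQ ?_ ?_ ?_ ?_)
    (.symm _ _ (c.XS_cross hY v₀ hB hQ ?_ ?_ ?_ ?_))
  · refine inf_of_diff i1 hf fun z => ?_
    simp only [Set.mem_sdiff, Set.mem_inter_iff, Set.mem_union]; tauto
  · refine inf_of_diff i2 hf fun z => ?_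
    simp only [Set.mem_sdiff, Set.mem_inter_iff, Set.mem_union, Set.mem_compl_iff]; tauto
  · refine inf_of_diff i1' hf fun z => ?_
    simp only [Set.mem_sdiff, Set.mem_inter_iff, Set.mem_union, Set.mem_compl_iff]; tauto
  · refine inf_of_diff i2' hf fun z => ?_
    simp only [Set.mem_sdiff, Set.mem_inter_iff, Set.mem_union, Set.mem_compl_iff]; tauto
  · refine inf_of_diff i1' hf fun z => ?_
    simp only [Set.mem_sdiff, Set.mem_inter_iff, Set.mem_union]; tauto
  · refine inf_of_diff i2' hf fun z => ?_
    simp only [Set.mem_sdiff, Set.mem_inter_iff, Set.mem_union, Set.mem_compl_iff]; tauto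
  · refine inf_of_diff i1 hf fun z => ?_
    simp only [Set.mem_sdiff, Set.mem_inter_iff, Set.mem_union, Set.mem_compl_iff]; tauto
  · refine inf_of_diff i2 hf fun z => ?_
    simp only [Set.mem_sdiff, Set.mem_inter_iff, Set.mem_union, Set.mem_compl_iff]; tauto

theorem Ctx.link (c : Ctx G T E) (hY : IsCylinder T G Y) (v₀ : V) {A B : Set V}
    (hA : IsSpecialForest T A Y) (hB : IsSpecialForest T B Y) (sA : Split T Y A)
    (sA' : Split T Y Aᶜ) (sB : Split T Y B) (sB' : Split T Y Bᶜ) :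
    ccRel T G v₀ (XS G v₀ A) (XS G v₀ B) := by
  have cA := c.XS_compl hY v₀ hA sA.inf sA'.inf
  have cB := c.XS_compl hY v₀ hB sB.inf sB'.inf
  by_cases h1 : (A ∩ B).Finite
  · exact c.link1 hY v₀ hA hB sA sB h1
  by_cases h2 : (A ∩ Bᶜ).Finite
  · exact .trans _ _ _ (c.link1 hY v₀ hA (Sp.compl hB) sA sB' h2) (.symm _ _ cB)
  by_cases h3 : (Aᶜ ∩ B).Finite
  · exact .trans _ _ _ cA (c.link1 hY v₀ (Sp.compl hA) hB sA' sB h3)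
  by_cases h4 : (Aᶜ ∩ Bᶜ).Finite
  · exact .trans _ _ _ cA (.trans _ _ _ (c.link1 hY v₀ (Sp.compl hA) (Sp.compl hB) sA' sB' h4)
      (.symm _ _ cB))
  exact c.XS_cross hY v₀ hA hB h1 h2 h3 h4

theorem Ctx.split_of (c : Ctx G T E) (hY : IsCylinder T G Y) {S : Set V}
    (hS : IsSpecialForest T S Y) (hi : S.Infinite)
    (hp : ∀ v ∈ cylBoundary T Y, FiniteValenceIn Y v → ¬ (S ∆ periForest T Y v).Finite) :
    Split T Y S := by
  by_contra hn
  obtain ⟨v, hv, hf, h⟩ := c.atom hY hS hi (by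
    intro x y hxy hxyY
    by_contra hc
    push Not at hc
    exact hn ⟨x, y, hxy, hxyY, hc.1, hc.2⟩)
  exact hp v hv hf h

theorem Ctx.nonperi (c : Ctx G T E) (hY : IsCylinder T G Y) {C : Set (Set G)}
    (hC : IsCCC T G v₀ C) (hb : CCCBasedOn G Y C) (hp : ¬ PeripheralCCC T G v₀ C) :
    ∃ S, IsSpecialForest T S Y ∧ Split T Y S ∧ Split T Y Sᶜ ∧ C = ccOf T G v₀ (XS G v₀ S) := by
  obtain ⟨X0, hX0, rfl⟩ := hC
  obtain ⟨X, hX, H, ⟨e, he, hHe⟩, hn⟩ := hb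
  have hXN : X ∈ NontrivB T G v₀ := (ccRel_NB hX).1 hX0
  obtain ⟨Y', e', S, r⟩ := c.NB_rep hXN
  have hYY : Y = Y' := hY.eq r.hY he r.he (hHe.symm.trans (r.comm c hn))
  subst hYY
  obtain ⟨-, i1, i2⟩ := c.comm_of_rep r.hY r.hS r.he hn r.hr
  have hXS : ccRel T G v₀ X0 (XS G v₀ S) := .trans _ _ _ hX (r.rel c hXN)
  have hcS := c.XS_compl hY v₀ r.hS i1 i2
  refine ⟨S, r.hS, ?_, ?_, ccOf_eq hXS⟩
  · refine c.split_of hY r.hS i1 fun v hv hf hfin => hp ⟨Y, v, hY, hv, hf, ?_⟩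
    exact .trans _ _ _ hXS (c.XS_equiv hY v₀ r.hS i1 i2 (peri_sp hf) hfin)
  · refine c.split_of hY (Sp.compl r.hS) i2 fun v hv hf hfin => hp ⟨Y, v, hY, hv, hf, ?_⟩
    exact .trans _ _ _ hXS (.trans _ _ _ hcS
      (c.XS_equiv hY v₀ (Sp.compl r.hS) i2 (by rwa [compl_compl]) (peri_sp hf) hfin))

/-! ### Boundaries with two or three points -/

theorem Ctx.four (c : Ctx G T E) (hY : IsCylinder T G Y) {S : Set V}
    (hS : IsSpecialForest T S Y) (s1 : Split T Y S) (s2 : Split T Y Sᶜ)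
    (hb : (cylBoundary T Y).Nonempty) (hf : (cylBoundary T Y).Finite) :
    4 ≤ (cylBoundary T Y).ncard := by
  classical
  obtain ⟨x, y, h, hxy, i1, i2⟩ := s1
  obtain ⟨x', y', h', hxy', i1', i2'⟩ := s2
  have p1 := c.sp_half h hxy
  have p2 := c.sp_half h' hxy'
  obtain ⟨a, ha, haS⟩ := c.exists_bd hY (Sp.inter hS p1) i1 hb
  obtain ⟨b, hb', hbS⟩ := c.exists_bd hY (Sp.inter hS (Sp.compl p1)) i2 hb
  obtain ⟨d, hd, hdS⟩ := c.exists_bd hY (Sp.inter (Sp.compl hS) p2) i1' hb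
  obtain ⟨f, hf', hfS⟩ := c.exists_bd hY (Sp.inter (Sp.compl hS) (Sp.compl p2)) i2' hb
  have n1 : a ≠ b := by rintro rfl; exact hbS.2 haS.2
  have n2 : a ≠ d := by rintro rfl; exact hdS.1 haS.1
  have n3 : a ≠ f := by rintro rfl; exact hfS.1 haS.1
  have n4 : b ≠ d := by rintro rfl; exact hdS.1 hbS.1
  have n5 : b ≠ f := by rintro rfl; exact hfS.1 hbS.1
  have n6 : d ≠ f := by rintro rfl; exact hfS.2 hdS.2
  have hcard : (({a, b, d, f} : Finset V) : Set V).ncard = 4 := by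
    rw [Set.ncard_coe_finset]
    simp [n1, n2, n3, n4, n5, n6]
  rw [← hcard]
  refine Set.ncard_le_ncard ?_ hf
  intro z hz
  simp only [Finset.coe_insert, Finset.coe_singleton, Set.mem_insert_iff,
    Set.mem_singleton_iff] at hz
  rcases hz with rfl | rfl | rfl | rfl <;> assumption

end Final

end SSRN
namespace SSRN

section Cross

variable {G V : Type*} [Group G] [MulAction G V] {T : SimpleGraph V} {E : Set (Subgroup G)}
  {Y : Set (Sym2 V)} {v₀ : V}

/-! ### Sets based on different cylinders do not cross -/

theorem Ctx.corner (c : Ctx G T E) {Y' : Set (Sym2 V)} {e e' : Sym2 V} {Z Z' : Set G}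
    {S S' : Set V} (r : Rep T v₀ Y e Z S) (r' : Rep T v₀ Y' e' Z' S') {H : Subgroup G}
    (hZ : NontrivAI H Z) (hi : S'.Infinite) (hd : ∀ w ∈ S, w ∉ S') {a : V} (hae : a ∈ e)
    (ha : a ∉ S') : HFin H (Z ∩ Z') := by
  have hH := r.comm c hZ
  obtain ⟨R, hR⟩ := c.bounded r.hY r.he hae r.hr v₀
  obtain ⟨K, hKe, hKc, hKS⟩ := c.exists_stab r'.hY r'.hS r'.he
  obtain ⟨a', ha'⟩ := sym2_exists e'
  have hW : (⋃ b ∈ cobdry T S', {x | x ∈ b}).Finite :=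
    r'.hS.1.biUnion fun b _ => sym2_finite b
  obtain ⟨M, hM⟩ : ∃ M : ℕ, ∀ b ∈ cobdry T S', ∀ x ∈ b, T.dist a' x ≤ M := by
    obtain ⟨M, hM⟩ := (hW.image (fun x => T.dist a' x)).bddAbove
    refine ⟨M, fun b hb x hx => hM ⟨x, ?_, rfl⟩⟩
    simp only [Set.mem_iUnion]
    exact ⟨b, hb, hx⟩
  have hfar : ∀ w ∈ S', T.dist a' w ≤ M + T.dist a w := by
    intro w hw
    classical
    obtain ⟨p, hp⟩ := c.hT.1.exists_walk_length_eq_dist a w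
    obtain ⟨b, hbp, hb⟩ := exists_cob (S := S') p (by tauto)
    obtain ⟨x, hx⟩ := sym2_exists b
    have hxp : x ∈ p.support := by
      induction b using Sym2.ind with
      | _ u v =>
        rcases Sym2.mem_iff.1 hx with rfl | rfl
        · exact p.fst_mem_support_of_mem_edges hbp
        · exact p.snd_mem_support_of_mem_edges hbp
    have h1 := hM b hb x hx
    have h2 : T.dist x w ≤ T.dist a w :=
      ((SimpleGraph.dist_le (p.dropUntil x hxp)).trans (p.length_dropUntil_le_length hxp)).trans hp.le
    have h3 := c.hT.1.dist_triangle (u := a') (v := x) (w := w)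
    omega
  obtain ⟨r0, hr0, hr0d⟩ := c.inf_far r'.hY r'.hS hi a' v₀ (M + R)
  have hk : ∀ k ∈ K, k * r0 ∉ Z := by
    intro k hk hkZ
    have h1 : (k * r0) • v₀ ∈ S' := by rw [mul_smul]; exact (hKS k hk _).2 hr0
    have h2 : k * r0 ∈ Z ∆ XS G v₀ S := Or.inl ⟨hkZ, fun h => hd _ h h1⟩
    have h3 := hR _ h2
    have h4 := hfar _ h1
    have h5 : T.dist a' ((k * r0) • v₀) = T.dist a' (r0 • v₀) := by
      conv_lhs => rw [← c.fix_mem (r'.hY.2.1 r'.he) (hKe hk) ha', mul_smul]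
      exact c.dist_smul _ _ _
    omega
  obtain ⟨F, hF⟩ := hfin_iff.1 (r'.hr.comm hKc)
  have hA : HFin H (⋃ f ∈ (F : Set G), Dif Z (f⁻¹ * r0)) :=
    HFin.biUnion F.finite_toSet fun f _ => hZ.1.dif _
  refine (hA.union (r.hr.comm hH)).mono ?_
  rintro g ⟨hg, hg'⟩
  by_cases hgS : g • v₀ ∈ S'
  · exact Or.inr (Or.inl ⟨hg, fun h => hd _ h hgS⟩)
  · obtain ⟨f, hf, k, hkK, hkf⟩ := hF g (Or.inl ⟨hg', hgS⟩)
    refine Or.inl ?_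
    simp only [Set.mem_iUnion]
    refine ⟨f, hf, fun h => hk k hkK ?_⟩
    have := h.1 hg
    rw [← hkf] at this
    simpa [mul_assoc] using this

theorem Ctx.verts_side (c : Ctx G T E) {Y' : Set (Sym2 V)} (hY : IsCylinder T G Y)
    (hY' : IsCylinder T G Y') (hne : Y ≠ Y') {S' : Set V} (hS' : IsSpecialForest T S' Y')
    {x w : V} (hx : x ∈ cylVerts Y) (hw : w ∈ cylVerts Y) : x ∈ S' ↔ w ∈ S' := by
  obtain ⟨p, hp⟩ := exists_path c.hT x w
  refine walk_iff p fun e he hc => hne ?_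
  exact hY.eq hY' (c.cyl_path hY hx hw p hp he) (hS'.2 hc) (Subgroup.Commensurable.refl _)

theorem Ctx.disj (c : Ctx G T E) {Y' : Set (Sym2 V)} (hY : IsCylinder T G Y) {S S' : Set V}
    (hS : IsSpecialForest T S Y) (hS' : IsSpecialForest T S' Y')
    (h1 : ∀ x ∈ cylVerts Y, x ∉ S') (h2 : ∀ x ∈ cylVerts Y', x ∉ S) : ∀ w ∈ S, w ∉ S' := by
  obtain ⟨a, ha⟩ := hY.exists_vert
  have : S ∩ S' = ∅ := by
    refine eq_empty_of_cob c.hT.1 (a := a) ?_ (fun h => h1 a ha h.2)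
    intro x y hxy
    by_cases k1 : s(x, y) ∈ cobdry T S
    · have e1 := h1 x ⟨_, hS.2 k1, by simp⟩
      have e2 := h1 y ⟨_, hS.2 k1, by simp⟩
      simp [e1, e2]
    by_cases k2 : s(x, y) ∈ cobdry T S'
    · have e1 := h2 x ⟨_, hS'.2 k2, by simp⟩
      have e2 := h2 y ⟨_, hS'.2 k2, by simp⟩
      simp [e1, e2]
    rw [cob_iff hxy, not_not] at k1 k2
    simp only [Set.mem_inter_iff, k1, k2]
  intro w hw hw'
  have : w ∈ S ∩ S' := ⟨hw, hw'⟩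
  simp_all

theorem Ctx.corner' (c : Ctx G T E) {Y' : Set (Sym2 V)} {e e' : Sym2 V} {Z Z' : Set G}
    {S S' : Set V} (r : Rep T v₀ Y e Z S) (r' : Rep T v₀ Y' e' Z' S') {H : Subgroup G}
    (hZ : NontrivAI H Z) (hi : S'.Infinite) (hne : Y ≠ Y') {a a' : V} (hae : a ∈ e)
    (hae' : a' ∈ e') (ha : a ∉ S') (ha' : a' ∉ S) : HFin H (Z ∩ Z') := by
  refine c.corner r r' hZ hi (c.disj r.hY r.hS r'.hS ?_ ?_) hae ha
  · intro x hx
    rwa [c.verts_side r.hY r'.hY hne r'.hS hx ⟨e, r.he, hae⟩]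
  · intro x hx
    rwa [c.verts_side r'.hY r.hY hne.symm r.hS hx ⟨e', r'.he, hae'⟩]

theorem Ctx.corner_same (c : Ctx G T E) {e e' : Sym2 V} {Z Z' : Set G}
    {S S' : Set V} (r : Rep T v₀ Y e Z S) (r' : Rep T v₀ Y e' Z' S') {H : Subgroup G}
    (hZ : NontrivAI H Z) (hd : S ∩ S' = ∅) : HFin H (Z ∩ Z') := by
  have hH := r.comm c hZ
  have hH' := hH.trans (r.hY.comm r.he r'.he)
  refine ((r.hr.comm hH).union (r'.hr.comm hH')).mono ?_
  rintro g ⟨hg, hg'⟩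
  by_cases h : g • v₀ ∈ S
  · refine Or.inr (Or.inl ⟨hg', fun h' => ?_⟩)
    have : g • v₀ ∈ S ∩ S' := ⟨h, h'⟩
    simp_all
  · exact Or.inl (Or.inl ⟨hg, h⟩)

theorem Ctx.nocross (c : Ctx G T E) {Y' : Set (Sym2 V)} {e e' : Sym2 V} {Z Z' : Set G}
    {S S' : Set V} (r : Rep T v₀ Y e Z S) (r' : Rep T v₀ Y' e' Z' S')
    (h : Y = Y' → (S ∩ S' = ∅ ∨ S ∩ S'ᶜ = ∅ ∨ Sᶜ ∩ S' = ∅ ∨ Sᶜ ∩ S'ᶜ = ∅)) :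
    ¬ CrossesAny Z Z' := by
  rintro ⟨H, K, hZ, hZ', h1, h2, h3, h4⟩
  by_cases hne : Y = Y'
  · replace h := h hne
    subst hne
    rcases h with h | h | h | h
    · exact h1 (c.corner_same r r' hZ h)
    · exact h2 (c.corner_same r r'.compl hZ h)
    · exact h3 (c.corner_same r.compl r' hZ.compl h)
    · exact h4 (c.corner_same r.compl r'.compl hZ.compl h)
  · obtain ⟨-, i1, i2⟩ := c.comm_of_rep r'.hY r'.hS r'.he hZ' r'.hr
    obtain ⟨a, ha⟩ := sym2_exists e
    obtain ⟨a', ha'⟩ := sym2_exists e'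
    by_cases k1 : a ∈ S' <;> by_cases k2 : a' ∈ S
    · exact h4 (c.corner' r.compl r'.compl hZ.compl i2 hne ha ha' (by simpa) (by simpa))
    · exact h2 (c.corner' r r'.compl hZ i2 hne ha ha' (by simpa) (by simpa))
    · exact h3 (c.corner' r.compl r' hZ.compl i1 hne ha ha' (by simpa) (by simpa))
    · exact h1 (c.corner' r r' hZ i1 hne ha ha' (by simpa) (by simpa))

/-! ### Peripheral components -/

/-- `Z` determines the same pair as the peripheral set at `v`. -/
def PeriP (T : SimpleGraph V) (v₀ : V) (Y : Set (Sym2 V)) (e : Sym2 V) (v : V) (Z : Set G) : Prop :=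
  Rep T v₀ Y e Z (periForest T Y v) ∨ Rep T v₀ Y e Z (periForest T Y v)ᶜ

theorem PeriP.compl {e : Sym2 V} {v : V} {Z : Set G} (h : PeriP T v₀ Y e v Z) :
    PeriP T v₀ Y e v Zᶜ := by
  rcases h with h | h
  · exact Or.inr h.compl
  · left
    have := h.compl
    rwa [compl_compl] at this

theorem PeriP.congr {e : Sym2 V} {v : V} {Z Z' : Set G} (h : PeriP T v₀ Y e v Z)
    (hf : HFin (edgeStab G e) (Z ∆ Z')) : PeriP T v₀ Y e v Z' := by
  rw [symmDiff_comm] at hf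
  rcases h with h | h
  · exact Or.inl ⟨h.hY, h.he, h.hS, hfin_symmDiff_trans hf h.hr⟩
  · exact Or.inr ⟨h.hY, h.he, h.hS, hfin_symmDiff_trans hf h.hr⟩

theorem PeriP.comm (c : Ctx G T E) {e : Sym2 V} {v : V} {Z : Set G} (h : PeriP T v₀ Y e v Z)
    {H : Subgroup G} (hZ : NontrivAI H Z) : Subgroup.Commensurable H (edgeStab G e) := by
  rcases h with h | h
  · exact h.comm c hZ
  · exact h.comm c hZ

theorem Ctx.peri_corner (c : Ctx G T E) (hY : IsCylinder T G Y) {v : V} (hv : v ∈ cylVerts Y)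
    {S : Set V} (hS : IsSpecialForest T S Y) :
    periForest T Y v ∩ S = ∅ ∨ periForest T Y v ∩ Sᶜ = ∅ := by
  by_cases h : v ∈ S
  · right
    refine Set.eq_empty_of_forall_notMem fun z hz => hz.2 ((c.peri_sub hY hv hS hz.1).1 h)
  · left
    refine Set.eq_empty_of_forall_notMem fun z hz => h ((c.peri_sub hY hv hS hz.1).2 hz.2)

theorem Ctx.peri_nocross (c : Ctx G T E) {e : Sym2 V} {v : V} (hv : v ∈ cylVerts Y)
    {Z Z' : Set G} (h : PeriP T v₀ Y e v Z) (hZ' : Z' ∈ NontrivB T G v₀) :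
    ¬ CrossesAny Z Z' ∧ ¬ CrossesAny Z' Z := by
  obtain ⟨Y', e', S, r⟩ := c.NB_rep hZ'
  rcases h with h | h
  · refine ⟨c.nocross h r ?_, c.nocross r h ?_⟩
    · rintro rfl
      rcases c.peri_corner r.hY hv r.hS with k | k
      · exact Or.inl k
      · exact Or.inr (Or.inl k)
    · rintro rfl
      rcases c.peri_corner r.hY hv r.hS with k | k
      · left; rwa [Set.inter_comm]
      · right; right; left; rwa [Set.inter_comm]
  · refine ⟨c.nocross h r ?_, c.nocross r h ?_⟩
    · rintro rfl
      rw [compl_compl]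
      rcases c.peri_corner r.hY hv r.hS with k | k
      · right; right; left; exact k
      · right; right; right; exact k
    · rintro rfl
      rw [compl_compl]
      rcases c.peri_corner r.hY hv r.hS with k | k
      · right; left; rwa [Set.inter_comm]
      · right; right; right; rwa [Set.inter_comm]

theorem Ctx.peri_same (c : Ctx G T E) {e : Sym2 V} {v : V} {Z Z' : Set G}
    (hZ : Z ∈ NontrivB T G v₀) {K : Subgroup G} (hK : NontrivAI K Z') {H : Subgroup G}
    (hH : NontrivAI H Z) (hf : HFin H (Z ∆ Z')) :
    PeriP T v₀ Y e v Z ↔ PeriP T v₀ Y e v Z' := by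
  constructor
  · intro h
    exact h.congr (hf.comm (h.comm c hH).symm)
  · intro h
    obtain ⟨Y1, e1, S1, r⟩ := c.NB_rep hZ
    have h1 := r.comm c hH
    have hf' := hf
    rw [symmDiff_comm] at hf'
    have r' : Rep T v₀ Y1 e1 Z' S1 :=
      ⟨r.hY, r.he, r.hS, hfin_symmDiff_trans (hf'.comm h1.symm) r.hr⟩
    have h2 := r'.comm c hK
    have h3 := h.comm c hK
    exact h.congr (hf'.comm (h3.symm.trans (h2.trans h1.symm)))

theorem Ctx.peri_step' (c : Ctx G T E) {e : Sym2 V} {v : V} (hv : v ∈ cylVerts Y)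
    {Z Z' : Set G} (h : ccStep T G v₀ Z Z') :
    PeriP T v₀ Y e v Z ↔ PeriP T v₀ Y e v Z' := by
  obtain ⟨hZ, hZ', h | ⟨H, hH, h⟩⟩ := h
  · exact ⟨fun hp => absurd h (c.peri_nocross hv hp hZ').1,
      fun hp => absurd h (c.peri_nocross hv hp hZ).2⟩
  · obtain ⟨K, hK⟩ := hZ'.2
    rcases h with h | h
    · exact c.peri_same hZ hK hH h
    · rw [c.peri_same hZ hK.compl hH h]
      refine ⟨fun k => ?_, fun k => k.compl⟩
      have := k.compl
      rwa [compl_compl] at this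

theorem Ctx.peri_rel (c : Ctx G T E) {e : Sym2 V} {v : V} (hv : v ∈ cylVerts Y)
    {Z Z' : Set G} (h : ccRel T G v₀ Z Z') :
    PeriP T v₀ Y e v Z ↔ PeriP T v₀ Y e v Z' := by
  induction h with
  | rel x y h => exact c.peri_step' hv h
  | refl x => rfl
  | symm x y _ ih => exact ih.symm
  | trans x y z _ _ ih ih' => exact ih.trans ih'

/-- `S` is not equivalent to a peripheral forest based on `Y` or to its complement. -/
def NonPeri (T : SimpleGraph V) (Y : Set (Sym2 V)) (S : Set V) : Prop :=
  ∀ v ∈ cylBoundary T Y, FiniteValenceIn Y v →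
    (S ∆ periForest T Y v).Infinite ∧ (S ∆ (periForest T Y v)ᶜ).Infinite

theorem Ctx.ccOf_nonperi (c : Ctx G T E) (hY : IsCylinder T G Y) {S : Set V}
    (hS : IsSpecialForest T S Y) (h1 : S.Infinite) (h2 : Sᶜ.Infinite) (hn : NonPeri T Y S) :
    ¬ PeripheralCCC T G v₀ (ccOf T G v₀ (XS G v₀ S)) := by
  rintro ⟨Y', v, hY', hv, hf, hC⟩
  obtain ⟨e', he'⟩ := hY'.1
  obtain ⟨e, he⟩ := hY.1
  have hP : PeriP T v₀ Y' e' v (XvY T G v₀ Y' v) := Or.inl (Rep.self hY' he' (peri_sp hf))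
  rw [← c.peri_rel hv.1 hC] at hP
  obtain ⟨K, hK, hKn⟩ := c.XS_nontriv hY hS he v₀ h1 h2
  have hYY : Y = Y' := hY.eq hY' he he' (hK.symm.trans (hP.comm c hKn))
  subst hYY
  obtain ⟨i1, i2⟩ := hn v hv hf
  rcases hP with hP | hP
  · exact c.not_hfin hY (Sp.symmDiff hS hP.hS) he' v₀ i1 hP.hr
  · exact c.not_hfin hY (Sp.symmDiff hS hP.hS) he' v₀ i2 hP.hr

/-! ### Existence -/

theorem Ctx.nonperi_of_four (c : Ctx G T E) (hY : IsCylinder T G Y) {v1 v2 v3 v4 : V}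
    (h1 : v1 ∈ cylBoundary T Y) (h2 : v2 ∈ cylBoundary T Y) (h3 : v3 ∈ cylBoundary T Y)
    (h4 : v4 ∈ cylBoundary T Y) (n12 : v1 ≠ v2) (n13 : v1 ≠ v3) (n14 : v1 ≠ v4) (n23 : v2 ≠ v3)
    (n24 : v2 ≠ v4) (n34 : v3 ≠ v4) :
    ∃ S, IsSpecialForest T S Y ∧ S.Infinite ∧ Sᶜ.Infinite ∧ NonPeri T Y S := by
  obtain ⟨x13, y13, a13, e13, p13, q13⟩ := c.sep hY h1.1 h3.1 n13
  obtain ⟨x14, y14, a14, e14, p14, q14⟩ := c.sep hY h1.1 h4.1 n14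
  obtain ⟨x23, y23, a23, e23, p23, q23⟩ := c.sep hY h2.1 h3.1 n23
  obtain ⟨x24, y24, a24, e24, p24, q24⟩ := c.sep hY h2.1 h4.1 n24
  have hS := Sp.union (Sp.inter (c.sp_half a13 e13) (c.sp_half a14 e14))
    (Sp.inter (c.sp_half a23 e23) (c.sp_half a24 e24))
  generalize hSS : (halfTree T x13 y13 ∩ halfTree T x14 y14 ∪
    halfTree T x23 y23 ∩ halfTree T x24 y24) = S at hS
  have m1 : v1 ∈ S := by rw [← hSS]; exact Or.inl ⟨p13, p14⟩
  have m2 : v2 ∈ S := by rw [← hSS]; exact Or.inr ⟨p23, p24⟩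
  have m3 : v3 ∉ S := by rw [← hSS]; rintro (h | h); exacts [q13 h.1, q23 h.1]
  have m4 : v4 ∉ S := by rw [← hSS]; rintro (h | h); exacts [q14 h.2, q24 h.2]
  refine ⟨S, hS, c.bd_infinite hY hS h1 m1, c.bd_infinite hY (Sp.compl hS) h3 m3, ?_⟩
  intro v hv hf
  have hsp := peri_sp (T := T) hf
  constructor
  · obtain ⟨w, hw, hwS, hne⟩ : ∃ w ∈ cylBoundary T Y, w ∈ S ∧ v ≠ w := by
      by_cases h : v = v1
      · exact ⟨v2, h2, m2, by rwa [h]⟩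
      · exact ⟨v1, h1, m1, h⟩
    exact c.bd_infinite hY (Sp.symmDiff hS hsp) hw
      (Or.inl ⟨hwS, c.peri_not hY hv.1 hw.1 hne⟩)
  · obtain ⟨w, hw, hwS, hne⟩ : ∃ w ∈ cylBoundary T Y, w ∉ S ∧ v ≠ w := by
      by_cases h : v = v3
      · exact ⟨v4, h4, m4, by rwa [h]⟩
      · exact ⟨v3, h3, m3, h⟩
    exact c.bd_infinite hY (Sp.symmDiff hS (Sp.compl hsp)) hw
      (Or.inr ⟨c.peri_not hY hv.1 hw.1 hne, hwS⟩)

theorem Ctx.exists_nonperi (c : Ctx G T E) (hY : IsCylinder T G Y)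
    (h : (cylBoundary T Y).Finite →
        (cylBoundary T Y).ncard ≠ 2 ∧ (cylBoundary T Y).ncard ≠ 3) :
    ∃ S, IsSpecialForest T S Y ∧ S.Infinite ∧ Sᶜ.Infinite ∧ NonPeri T Y S := by
  obtain ⟨x, y, hxy, hxyY⟩ : ∃ x y, T.Adj x y ∧ s(x, y) ∈ Y := by
    obtain ⟨e, he⟩ := hY.1
    induction e using Sym2.ind with
    | _ x y => exact ⟨x, y, hY.2.1 he, he⟩
  have hS := c.sp_half hxy hxyY
  have i1 := c.ht_infinite hxy
  have i2 := c.ht_infinite hxy.symm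
  rw [ht_compl c.hT hxy] at i2
  rcases (cylBoundary T Y).eq_empty_or_nonempty with hb | hb
  · refine ⟨_, hS, i1, i2, fun v hv => ?_⟩
    rw [hb] at hv
    exact absurd hv (Set.notMem_empty v)
  · obtain ⟨a, ha, haS⟩ := c.exists_bd hY hS i1 hb
    obtain ⟨b, hb', hbS⟩ := c.exists_bd hY (Sp.compl hS) i2 hb
    have hab : a ≠ b := by rintro rfl; exact hbS haS
    obtain ⟨t, ht, htc⟩ : ∃ t : Finset V, (t : Set V) ⊆ cylBoundary T Y ∧ t.card = 4 := by
      by_cases hfin : (cylBoundary T Y).Finite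
      · have h2 : 1 < (cylBoundary T Y).ncard :=
          (Set.one_lt_ncard hfin).2 ⟨a, ha, b, hb', hab⟩
        have h4 : 4 ≤ hfin.toFinset.card := by
          rw [← Set.ncard_eq_toFinset_card _ hfin]
          have := h hfin
          omega
        obtain ⟨t, ht, htc⟩ := Finset.exists_subset_card_eq h4
        exact ⟨t, fun z hz => hfin.mem_toFinset.1 (ht hz), htc⟩
      · exact Set.Infinite.exists_subset_card_eq hfin 4
    have eqv := (t.equivFinOfCardEq htc).symm
    have hm : ∀ i, (eqv i : V) ∈ cylBoundary T Y := fun i => ht (eqv i).2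
    have hi : ∀ i j, i ≠ j → (eqv i : V) ≠ eqv j := fun i j hij h =>
      hij (eqv.injective (Subtype.ext h))
    exact c.nonperi_of_four hY (hm 0) (hm 1) (hm 2) (hm 3) (hi _ _ (by decide))
      (hi _ _ (by decide)) (hi _ _ (by decide)) (hi _ _ (by decide)) (hi _ _ (by decide))
      (hi _ _ (by decide))

end Cross

end SSRN
namespace SSRN

/-- For every cylinder `Y` there is at most one non-peripheral
cross-connected component of `B(T)` based on `Y`; one exists if and only if
`|∂Y| ∉ {2, 3}`. -/
theorem stmt_11 {G V : Type*} [Group G] [MulAction G V]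
    (hGfg : Group.FG G)
    (T : SimpleGraph V) (hT : T.IsTree) (hact : ActsOn T G) (hinv : NoInversions T G)
    (E : Set (Subgroup G)) (hE : Admissible E) (hET : IsETree T G E)
    (hmin : MinimalAction T G) (v₀ : V)
    (hval3 : ∀ w : V, ∃ a b c : V, a ≠ b ∧ a ≠ c ∧ b ≠ c ∧ T.Adj w a ∧ T.Adj w b ∧ T.Adj w c)
    (Y : Set (Sym2 V)) (hY : IsCylinder T G Y) :
    (∀ C C' : Set (Set G),
      IsCCC T G v₀ C → CCCBasedOn G Y C → ¬ PeripheralCCC T G v₀ C →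
      IsCCC T G v₀ C' → CCCBasedOn G Y C' → ¬ PeripheralCCC T G v₀ C' → C = C') ∧
    ((∃ C : Set (Set G), IsCCC T G v₀ C ∧ CCCBasedOn G Y C ∧ ¬ PeripheralCCC T G v₀ C) ↔
      ((cylBoundary T Y).Finite →
        (cylBoundary T Y).ncard ≠ 2 ∧ (cylBoundary T Y).ncard ≠ 3)) := by
  have c : Ctx G T E := ⟨hT, hact, hinv, hE, hET, hmin, hval3⟩
  refine ⟨?_, ?_, ?_⟩
  · intro C C' h1 h2 h3 h1' h2' h3'
    obtain ⟨S, hS, s1, s2, rfl⟩ := c.nonperi hY h1 h2 h3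
    obtain ⟨S', hS', s1', s2', rfl⟩ := c.nonperi hY h1' h2' h3'
    exact ccOf_eq (c.link hY v₀ hS hS' s1 s2 s1' s2')
  · rintro ⟨C, h1, h2, h3⟩ hf
    obtain ⟨S, hS, s1, s2, rfl⟩ := c.nonperi hY h1 h2 h3
    rcases (cylBoundary T Y).eq_empty_or_nonempty with hb | hb
    · rw [hb]; simp
    · have := c.four hY hS s1 s2 hb hf
      omega
  · intro h
    obtain ⟨S, hS, i1, i2, hn⟩ := c.exists_nonperi hY h
    obtain ⟨e, he⟩ := hY.1
    obtain ⟨K, hK, hKn⟩ := c.XS_nontriv hY hS he v₀ i1 i2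
    exact ⟨ccOf T G v₀ (XS G v₀ S), ⟨_, c.XS_NB hY v₀ hS i1 i2, rfl⟩,
      ⟨_, .refl _, K, ⟨e, he, hK⟩, hKn⟩, c.ccOf_nonperi hY hS i1 i2 hn⟩

end SSRN
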